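/- arXiv:1511.03478 — 2 statements merged into one kernel-verified Lean document; each statement's English description precedes it below -/
import Mathlib

section
/- Suppose flows γ, γ' on compact metric spaces Y, Y' have cross sections C, C' whose return maps (C, ρ_C) and (C', ρ_{C'}) are topologically conjugate to irreducible shifts of finite type. Suppose h : Y → Y' is a flow equivalence such that for each closed orbit (circle) 𝒞 in Y, the cardinality of 𝒞 ∩ C equals the cardinality of h(𝒞) ∩ C'. Then there exists k ∈ Homeo₊ⁱˢᵒ(Y) such that the flow equivalence g = h ∘ k satisfies g⁻¹(C') = C and the restriction g|_C : C → C' is a homeomorphism with g ∘ ρ_C = ρ_{C'} ∘ g on C (i.e., g is induced by a topological conjugacy of the return maps, hence of the given SFTs). -/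
open Set Topology

section FlowDefs

variable {Y Y' : Type*} [TopologicalSpace Y] [TopologicalSpace Y']

/-- A fixed point free continuous flow on a topological space. -/
def IsFlow (γ : Y → ℝ → Y) : Prop :=
  Continuous (fun p : Y × ℝ => γ p.1 p.2) ∧
  (∀ y s t, γ (γ y s) t = γ y (s + t)) ∧
  (∀ y, γ y 0 = y) ∧
  (∀ y, ∃ t, γ y t ≠ y)

/-- The orbit of a point under a flow. -/
def flowOrbit (γ : Y → ℝ → Y) (y : Y) : Set Y := Set.range (γ y)

/-- A cross section of a flow: a closed subset `C` such that
`(x,t) ↦ γ x t` is surjective `C × ℝ → Y` and a local homeomorphism. -/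
def IsCrossSection (γ : Y → ℝ → Y) (C : Set Y) : Prop :=
  IsClosed C ∧
  Function.Surjective (fun p : C × ℝ => γ p.1.1 p.2) ∧
  IsLocalHomeomorph (fun p : C × ℝ => γ p.1.1 p.2)

/-- A flow map: a continuous map sending each orbit onto an orbit by an
orientation preserving local homeomorphism. -/
def IsFlowMap (γ : Y → ℝ → Y) (γ' : Y' → ℝ → Y') (h : Y → Y') : Prop :=
  Continuous h ∧
  (∀ y, h '' flowOrbit γ y = flowOrbit γ' (h y)) ∧
  (∀ y, ∃ ε > (0:ℝ), ∃ c : ℝ → ℝ,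
    ContinuousOn c (Ioo (-ε) ε) ∧ StrictMonoOn c (Ioo (-ε) ε) ∧ c 0 = 0 ∧
    ∀ t : ℝ, |t| < ε → h (γ y t) = γ' (h y) (c t))

/-- Membership in `Homeo₊(Y)`: a self flow equivalence. -/
def MemHomeoPlus (γ : Y → ℝ → Y) (h : Y → Y) : Prop :=
  IsFlowMap γ γ h ∧ IsHomeomorph h

/-- Membership in `Homeo₊ᵒʳᵇ(Y)`: a self flow equivalence mapping each orbit onto itself. -/
def MemHomeoPlusOrb (γ : Y → ℝ → Y) (h : Y → Y) : Prop :=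
  MemHomeoPlus γ h ∧ ∀ y, h '' flowOrbit γ y = flowOrbit γ y

/-- Membership in `Homeo₊ⁱˢᵒ(Y)`: an element of `Homeo₊ᵒʳᵇ(Y)` isotopic to the identity
within `Homeo₊(Y)`. -/
def MemHomeoPlusIso (γ : Y → ℝ → Y) (h : Y → Y) : Prop :=
  MemHomeoPlusOrb γ h ∧
  ∃ H : Y → ℝ → Y,
    ContinuousOn (fun p : Y × ℝ => H p.1 p.2) (Set.univ ×ˢ Set.Icc 0 1) ∧
    (∀ t ∈ Set.Icc (0:ℝ) 1, MemHomeoPlus γ (fun y => H y t)) ∧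
    (∀ y, H y 0 = y) ∧ (∀ y, H y 1 = h y)

/-- A discrete cross section for a (homeomorphic) self-map `T` of a space:
a closed set meeting every orbit, with well-defined continuous return time. -/
def IsDiscreteCrossSection {Z : Type*} [TopologicalSpace Z] (T : Z → Z) (K : Set Z) : Prop :=
  IsClosed K ∧
  (∀ z : Z, ∃ x ∈ K, ∃ k : ℕ, T^[k] x = z) ∧
  ∃ r : K → ℕ, Continuous r ∧ ∀ x : K, IsLeast {k : ℕ | 1 ≤ k ∧ T^[k] (x : Z) ∈ K} (r x)

end FlowDefs

section SubshiftDefs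

/-- The left shift on bisequences. -/
def shiftMap {A : Type*} : (ℤ → A) → (ℤ → A) := fun x n => x (n + 1)

/-- The word `w` occurs in `x` at position `n`. -/
def wordOccursAt {A : Type*} (w : List A) (x : ℤ → A) (n : ℤ) : Prop :=
  ∀ (i : ℕ) (hi : i < w.length), x (n + i) = w.get ⟨i, hi⟩

/-- The word `w` occurs in some point of `X`. -/
def wordOccursIn {A : Type*} (w : List A) (X : Set (ℤ → A)) : Prop :=
  ∃ x ∈ X, ∃ n : ℤ, wordOccursAt w x n

/-- A subshift: nonempty, closed, shift-invariant subset of `A^ℤ`. -/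
def IsSubshift {A : Type*} [TopologicalSpace A] (X : Set (ℤ → A)) : Prop :=
  X.Nonempty ∧ IsClosed X ∧ shiftMap '' X = X

/-- A shift of finite type: the set of bisequences avoiding a finite set of forbidden words. -/
def IsSFT {A : Type*} (X : Set (ℤ → A)) : Prop :=
  ∃ F : Set (List A), F.Finite ∧ X = {x | ∀ w ∈ F, ∀ n : ℤ, ¬ wordOccursAt w x n}

/-- An irreducible subshift. -/
def IsIrreducibleSubshift {A : Type*} (X : Set (ℤ → A)) : Prop :=
  ∀ u v : List A, wordOccursIn u X → wordOccursIn v X →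
    ∃ w : List A, wordOccursIn (u ++ w ++ v) X

end SubshiftDefs

section PhaseCocycle

open Filter

variable {Y : Type*} [TopologicalSpace Y]

lemma coe_unitAddCircle_eq_iff {x y : ℝ} :
    (x : UnitAddCircle) = y ↔ ∃ n : ℤ, x = y + n := by
  rw [← sub_eq_zero, ← AddCircle.coe_sub, AddCircle.coe_eq_zero_iff]
  constructor
  · rintro ⟨n, hn⟩
    exact ⟨n, by simp at hn; linarith⟩
  · rintro ⟨n, hn⟩
    exact ⟨n, by simp; linarith⟩

lemma eq_of_coe_unitAddCircle_eq {x y : ℝ} (h : (x : UnitAddCircle) = y) (hxy : |x - y| < 1) :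
    x = y := by
  obtain ⟨n, hn⟩ := coe_unitAddCircle_eq_iff.1 h
  have : |(n : ℝ)| < 1 := by rwa [show (n : ℝ) = x - y by linarith]
  have hn0 : n = 0 := by
    rw [← Int.abs_lt_one_iff]
    exact_mod_cast this
  simpa [hn0] using hn

lemma eq_of_continuous_of_coe_eq {f g : ℝ → ℝ} (hf : Continuous f) (hg : Continuous g)
    (h : ∀ t, (f t : UnitAddCircle) = g t) (h0 : f 0 = g 0) (t : ℝ) : f t = g t :=
  congrFun ((AddCircle.isCoveringMap_coe (1 : ℝ)).eq_of_comp_eq hf hg (funext h) 0 h0) t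

/-- A continuous circle-valued function which strictly increases along the flow lines. -/
def IsCirclePhase (γ : Y → ℝ → Y) (θ : Y → UnitAddCircle) : Prop :=
  Continuous θ ∧ ∀ y, ∃ e : ℝ → ℝ, Tendsto e (𝓝[>] 0) (𝓝 0) ∧
    ∀ᶠ t in 𝓝[>] 0, 0 < e t ∧ θ (γ y t) = θ y + (e t : UnitAddCircle)

/-- A strictly increasing real cocycle lifting the increments of `θ` along the flow lines. -/
structure IsPhaseCocycle (γ : Y → ℝ → Y) (θ : Y → UnitAddCircle) (c : Y → ℝ → ℝ) : Prop where
  continuous : Continuous fun p : Y × ℝ => c p.1 p.2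
  add : ∀ y s t, c y (s + t) = c y s + c (γ y s) t
  strictMono : ∀ y, StrictMono (c y)
  coe : ∀ y t, θ (γ y t) = θ y + (c y t : UnitAddCircle)

lemma strictMono_of_forall_eventually_lt {f : ℝ → ℝ} (hf : Continuous f)
    (h : ∀ t, ∀ᶠ s in 𝓝[>] t, f t < f s) : StrictMono f := by
  have mono : Monotone f := by
    intro a b hab
    have hsub : Icc a b ⊆ {t | f a ≤ f t} := by
      refine IsClosed.Icc_subset_of_forall_exists_gt ?_ (le_refl (f a)) ?_
      · exact (isClosed_le continuous_const hf).inter isClosed_Icc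
      · rintro x ⟨hx, -⟩ y hy
        obtain ⟨z, hz, hz'⟩ := ((h x).and (Ioc_mem_nhdsGT hy)).exists
        exact ⟨z, hx.trans hz.le, hz'⟩
    exact hsub (right_mem_Icc.2 hab)
  intro a b hab
  obtain ⟨z, hz, hz'⟩ := ((h a).and (Ioc_mem_nhdsGT hab)).exists
  exact hz.trans_le (mono hz'.2)

lemma exists_lift_increment {γ : Y → ℝ → Y} (hγc : Continuous fun p : Y × ℝ => γ p.1 p.2)
    (hγ0 : ∀ y, γ y 0 = y) {θ : Y → UnitAddCircle} (hθ : Continuous θ) :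
    ∃ c : Y → ℝ → ℝ, Continuous (fun p : Y × ℝ => c p.1 p.2) ∧ (∀ y, c y 0 = 0) ∧
      ∀ y t, ((c y t : ℝ) : UnitAddCircle) = θ (γ y t) - θ y := by
  obtain ⟨L, hL⟩ : ∃ L : C(unitInterval × (Y × ℝ), ℝ), ∀ r y t,
      ((L (r, (y, t)) : ℝ) : UnitAddCircle) = θ (γ y (r * t)) - θ y := by
    have hH : Continuous fun p : unitInterval × (Y × ℝ) =>
        θ (γ p.2.1 (p.1 * p.2.2)) - θ p.2.1 :=
      (hθ.comp (hγc.comp (f := fun p : unitInterval × (Y × ℝ) =>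
        (p.2.1, (p.1 : ℝ) * p.2.2)) (by fun_prop))).sub (by fun_prop)
    have H0 : ∀ a, (⟨_, hH⟩ : C(unitInterval × (Y × ℝ), UnitAddCircle)) (0, a) =
        (((0 : C(Y × ℝ, ℝ)) a : ℝ) : UnitAddCircle) := by
      intro a
      simp [hγ0]
    exact ⟨(AddCircle.isCoveringMap_coe (1 : ℝ)).liftHomotopy ⟨_, hH⟩ 0 H0, fun r y t =>
      congrFun ((AddCircle.isCoveringMap_coe (1 : ℝ)).liftHomotopy_lifts ⟨_, hH⟩ 0 H0)
        (r, (y, t))⟩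
  refine ⟨fun y t => L (1, (y, t)) - L (1, (y, 0)), by fun_prop, by simp, fun y t => ?_⟩
  simp only [AddCircle.coe_sub, hL]
  simp [hγ0]

theorem IsCirclePhase.exists_cocycle {γ : Y → ℝ → Y} (hγ : IsFlow γ) {θ : Y → UnitAddCircle}
    (hθ : IsCirclePhase γ θ) : ∃ c, IsPhaseCocycle γ θ c := by
  obtain ⟨hγc, hγa, hγ0, -⟩ := hγ
  obtain ⟨hθc, hθm⟩ := hθ
  obtain ⟨c, hcc, hc0, hcoe⟩ := exists_lift_increment hγc hγ0 hθc
  have hcc' : ∀ y, Continuous (c y) := fun y => hcc.comp (Continuous.prodMk_right y)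
  have hadd : ∀ y s t, c y (s + t) = c y s + c (γ y s) t := by
    intro y s t
    refine eq_of_continuous_of_coe_eq (f := fun t => c y (s + t))
      (g := fun t => c y s + c (γ y s) t) ((hcc' y).comp (by fun_prop))
      (continuous_const.add (hcc' _)) (fun t => ?_) (by simp [hc0]) t
    rw [AddCircle.coe_add, hcoe, hcoe, hcoe, hγa]
    abel
  refine ⟨c, hcc, hadd, fun y => ?_, fun y t => by rw [hcoe]; abel⟩
  have key : ∀ y, ∀ᶠ s in 𝓝[>] (0 : ℝ), 0 < c y s := by
    intro y
    obtain ⟨e, he, hem⟩ := hθm y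
    have h1 : Tendsto (c y) (𝓝[>] 0) (𝓝 0) := by
      simpa [hc0] using ((hcc' y).tendsto 0).mono_left nhdsWithin_le_nhds
    have h2 : Tendsto (fun t => |c y t - e t|) (𝓝[>] 0) (𝓝 0) := by
      simpa using (h1.sub he).abs
    filter_upwards [hem, h2.eventually_lt_const one_pos] with t ht ht'
    rw [eq_of_coe_unitAddCircle_eq _ ht']
    · exact ht.1
    · rw [hcoe, ht.2]; abel
  refine strictMono_of_forall_eventually_lt (hcc' y) fun t => ?_
  have ht : Tendsto (fun s => s - t) (𝓝[>] t) (𝓝[>] 0) := by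
    refine tendsto_nhdsWithin_iff.2 ⟨?_, ?_⟩
    · have : Tendsto (fun s => s - t) (𝓝 t) (𝓝 (t - t)) := by
        exact (continuous_id.sub continuous_const).tendsto t
      simpa using this.mono_left nhdsWithin_le_nhds
    · filter_upwards [self_mem_nhdsWithin] with s hs
      exact mem_Ioi.2 (sub_pos.2 (mem_Ioi.1 hs))
  filter_upwards [ht.eventually (key (γ y t))] with s hs
  have := hadd y t (s - t)
  rw [add_sub_cancel] at this
  linarith

namespace IsPhaseCocycle

variable {γ : Y → ℝ → Y} {θ : Y → UnitAddCircle} {c : Y → ℝ → ℝ}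

lemma continuous_right (hc : IsPhaseCocycle γ θ c) (y : Y) : Continuous (c y) :=
  hc.continuous.comp (Continuous.prodMk_right y)

lemma zero (hγ : IsFlow γ) (hc : IsPhaseCocycle γ θ c) (y : Y) : c y 0 = 0 := by
  have := hc.add y 0 0
  rw [hγ.2.2.1, add_zero] at this
  linarith

lemma surjective (hγ : IsFlow γ) [CompactSpace Y] (hc : IsPhaseCocycle γ θ c) (y : Y) :
    Function.Surjective (c y) := by
  obtain ⟨m, hm, hmc⟩ : ∃ m > 0, ∀ z, m ≤ c z 1 := by
    have hcont : Continuous fun z => c z 1 := hc.continuous.comp (Continuous.prodMk_left 1)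
    have : Nonempty Y := ⟨y⟩
    obtain ⟨z, -, hz⟩ := isCompact_univ.exists_isMinOn univ_nonempty hcont.continuousOn
    refine ⟨c z 1, ?_, fun w => hz (mem_univ w)⟩
    rw [← hc.zero hγ z]
    exact hc.strictMono z one_pos
  have hn : ∀ (n : ℕ) z, n * m ≤ c z n := by
    intro n
    induction n with
    | zero => intro z; simp [hc.zero hγ]
    | succ n ih =>
      intro z
      have h1 := hc.add z n 1
      have h2 := hmc (γ z n)
      have h3 := ih z
      push_cast
      linarith
  intro r
  obtain ⟨n, hnr⟩ := exists_nat_gt (|r| / m)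
  rw [div_lt_iff₀ hm] at hnr
  refine mem_range_of_exists_le_of_exists_ge (hc.continuous_right y) ⟨-n, ?_⟩ ⟨n, ?_⟩
  · have h1 := hc.add y (-n) n
    rw [neg_add_cancel, hc.zero hγ] at h1
    have h2 := hn n (γ y (-n))
    have := neg_abs_le r
    linarith
  · have h2 := hn n y
    have := le_abs_self r
    linarith

end IsPhaseCocycle

end PhaseCocycle

section Counting

variable {Y : Type*} [TopologicalSpace Y] {γ : Y → ℝ → Y}

lemma flowOrbit_flow (hγ : IsFlow γ) (y : Y) (t : ℝ) :
    flowOrbit γ (γ y t) = flowOrbit γ y := by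
  ext z
  constructor
  · rintro ⟨s, rfl⟩
    exact ⟨t + s, (hγ.2.1 _ _ _).symm⟩
  · rintro ⟨s, rfl⟩
    exact ⟨-t + s, by rw [hγ.2.1]; congr 1; ring⟩

lemma flow_sub_period (hγ : IsFlow γ) {y : Y} {T : ℝ} (hT : γ y T = y) (t : ℝ) :
    γ y (t - T) = γ y t := by
  conv_lhs => rw [← hT]
  rw [hγ.2.1]
  congr 1
  ring

lemma flow_zsmul_period (hγ : IsFlow γ) {y : Y} {T : ℝ} (hT : γ y T = y) (n : ℤ) (t : ℝ) :
    γ y (t - n • T) = γ y t := by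
  induction n with
  | zero => simp
  | succ n ih =>
    rw [← ih, ← flow_sub_period hγ hT (t - (n : ℤ) • T)]
    congr 1
    rw [add_smul, one_smul]
    ring
  | pred n ih =>
    rw [← ih, ← flow_sub_period hγ hT (t - (-(n : ℤ) - 1) • T)]
    congr 1
    rw [sub_smul, one_smul]
    ring

lemma IsPhaseCocycle.exists_nat_eq_period (hγ : IsFlow γ) {θ : Y → UnitAddCircle} {c : Y → ℝ → ℝ}
    (hc : IsPhaseCocycle γ θ c) {y : Y} {T : ℝ} (hT0 : 0 < T) (hT : γ y T = y) :
    ∃ n : ℕ, c y T = n := by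
  have h := hc.coe y T
  rw [hT, left_eq_add, ← AddCircle.coe_zero, coe_unitAddCircle_eq_iff] at h
  obtain ⟨n, hn⟩ := h
  have hpos : c y 0 < c y T := hc.strictMono y hT0
  rw [hc.zero hγ, hn, zero_add] at hpos
  lift n to ℕ using by exact_mod_cast hpos.le
  exact ⟨n, by simpa using hn⟩

/-- The number of zeros of a phase on a closed orbit is the increment over the least period. -/
lemma IsPhaseCocycle.ncard_orbit [CompactSpace Y] (hγ : IsFlow γ) {θ : Y → UnitAddCircle}
    {c : Y → ℝ → ℝ} (hc : IsPhaseCocycle γ θ c) {y : Y} {T : ℝ}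
    (hT : IsLeast {t | 0 < t ∧ γ y t = y} T) :
    ((flowOrbit γ y ∩ {z | θ z = 0}).ncard : ℝ) = c y T := by
  wlog hy : θ y = 0 generalizing y
  · obtain ⟨r, hr⟩ := QuotientAddGroup.mk_surjective (θ y)
    obtain ⟨t, ht⟩ := hc.surjective hγ y (-r)
    have hper : ∀ s, γ (γ y t) s = γ y t ↔ γ y s = y := by
      intro s
      rw [hγ.2.1]
      constructor
      · intro h
        calc γ y s = γ (γ y (t + s)) (-t) := by rw [hγ.2.1]; congr 1; ring
          _ = y := by rw [h, hγ.2.1, add_neg_cancel, hγ.2.2.1]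
      · intro h
        rw [add_comm, ← hγ.2.1, h]
    have := this (y := γ y t) (by simpa only [hper] using hT) (by
      rw [hc.coe, ht, AddCircle.coe_neg, ← hr]
      exact add_neg_cancel _)
    rw [flowOrbit_flow hγ] at this
    rw [this]
    have h1 := hc.add y t T
    have h2 := hc.add y T t
    rw [hT.1.2] at h2
    rw [add_comm t T] at h1
    linarith
  obtain ⟨n, hn⟩ := hc.exists_nat_eq_period hγ hT.1.1 hT.1.2
  choose t ht using fun j : ℕ => hc.surjective hγ y j
  have hmem : ∀ j < n, 0 ≤ t j ∧ t j < T := by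
    intro j hj
    rw [← (hc.strictMono y).le_iff_le, ← (hc.strictMono y).lt_iff_lt, ht, hn, hc.zero hγ]
    exact ⟨by positivity, by exact_mod_cast hj⟩
  have himg : flowOrbit γ y ∩ {z | θ z = 0} = (fun j => γ y (t j)) '' (Finset.range n : Set ℕ) := by
    ext z
    constructor
    · rintro ⟨⟨s, rfl⟩, hz⟩
      obtain ⟨m, hm⟩ : ∃ m : ℤ, toIcoMod hT.1.1 0 s = s - m • T :=
        ⟨_, (self_sub_toIcoDiv_zsmul hT.1.1 0 s).symm⟩
      have hs := toIcoMod_mem_Ico hT.1.1 0 s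
      rw [← flow_zsmul_period hγ hT.1.2 m, ← hm] at hz ⊢
      generalize toIcoMod hT.1.1 0 s = r at *
      rw [zero_add] at hs
      have h0 := hc.coe y r
      rw [hz, hy, zero_add, ← AddCircle.coe_zero, eq_comm, coe_unitAddCircle_eq_iff] at h0
      obtain ⟨j, hj⟩ := h0
      have h1 := (hc.strictMono y).monotone hs.1
      have h2 := hc.strictMono y hs.2
      rw [hc.zero hγ, hj, zero_add] at h1
      rw [hn, hj, zero_add] at h2
      lift j to ℕ using by exact_mod_cast h1
      refine ⟨j, ?_, ?_⟩
      · simpa using h2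
      · have : t j = r := (hc.strictMono y).injective (by rw [ht, hj]; simp)
        simp only [this]
    · rintro ⟨j, -, rfl⟩
      refine ⟨⟨_, rfl⟩, ?_⟩
      have := hc.coe y (t j)
      rw [hy, ht, zero_add] at this
      rw [mem_ofPred, this, ← AddCircle.coe_zero, coe_unitAddCircle_eq_iff]
      exact ⟨j, by simp⟩
  rw [himg, InjOn.ncard_image, ncard_coe_finset, Finset.card_range, hn]
  have hlt : ∀ i < n, ∀ j < n, i < j → γ y (t i) ≠ γ y (t j) := by
    intro i hi j hj hij heq
    have hlt : t i < t j := by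
      rw [← (hc.strictMono y).lt_iff_lt, ht, ht]
      exact_mod_cast hij
    have hp : γ y (t j - t i) = y := by
      rw [sub_eq_add_neg, ← hγ.2.1, ← heq, hγ.2.1, add_neg_cancel, hγ.2.2.1]
    have := hT.2 ⟨sub_pos.2 hlt, hp⟩
    linarith [(hmem i hi).1, (hmem j hj).2]
  intro i hi j hj hij
  simp only [Finset.coe_range, mem_Iio] at hi hj
  rcases lt_trichotomy i j with h | h | h
  · exact absurd hij (hlt i hi j hj h)
  · exact h
  · exact absurd hij.symm (hlt j hj i hi h)

lemma IsPhaseCocycle.period_eq [CompactSpace Y] (hγ : IsFlow γ) {p q : Y → UnitAddCircle}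
    {a c : Y → ℝ → ℝ} (ha : IsPhaseCocycle γ p a) (hc : IsPhaseCocycle γ q c) {y : Y}
    (hcard : (flowOrbit γ y ∩ {z | p z = 0}).ncard = (flowOrbit γ y ∩ {z | q z = 0}).ncard)
    {T : ℝ} (hT0 : 0 < T) (hT : γ y T = y) : c y T = a y T := by
  obtain ⟨n, hn⟩ := ha.exists_nat_eq_period hγ hT0 hT
  induction n using Nat.strong_induction_on generalizing T with
  | _ n ih =>
    by_cases hleast : ∀ t, 0 < t → γ y t = y → T ≤ t
    · have hL : IsLeast {t | 0 < t ∧ γ y t = y} T := ⟨⟨hT0, hT⟩, fun t ht => hleast t ht.1 ht.2⟩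
      rw [← ha.ncard_orbit hγ hL, ← hc.ncard_orbit hγ hL, hcard]
    · push Not at hleast
      obtain ⟨S, hS0, hS, hST⟩ := hleast
      have hS' : γ y (T - S) = y := by rw [flow_sub_period hγ hS, hT]
      have hlt : ∀ R, 0 < R → R < T → γ y R = y → c y R = a y R := by
        intro R hR0 hRT hR
        obtain ⟨m, hm⟩ := ha.exists_nat_eq_period hγ hR0 hR
        refine ih m ?_ hR0 hR hm
        have := ha.strictMono y hRT
        rw [hm, hn] at this
        exact_mod_cast this
      have h1 := ha.add y S (T - S)
      have h2 := hc.add y S (T - S)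
      rw [add_sub_cancel, hS] at h1 h2
      rw [h1, h2, hlt S hS0 hST hS, hlt (T - S) (by linarith) (by linarith) hS']

end Counting

section Isotopy

open Filter

variable {Y : Type*} [TopologicalSpace Y] [CompactSpace Y] {γ : Y → ℝ → Y}

lemma flow_displacement_surjective (hγ : IsFlow γ) {β : Y → ℝ} (hβ : Continuous β) (y : Y) :
    Function.Surjective fun s => s + β (γ y s) := by
  obtain ⟨B, hB⟩ : ∃ B, ∀ y, |β y| ≤ B := by
    obtain ⟨B, hB⟩ := (isCompact_range hβ.abs).bddAbove
    exact ⟨B, fun y => hB ⟨y, rfl⟩⟩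
  have hcont : Continuous fun s => s + β (γ y s) :=
    continuous_id.add (hβ.comp (hγ.1.comp (Continuous.prodMk_right y)))
  intro r
  refine mem_range_of_exists_le_of_exists_ge hcont ⟨r - B, ?_⟩ ⟨r + B, ?_⟩
  · have := (abs_le.1 (hB (γ y (r - B)))).2
    linarith
  · have := (abs_le.1 (hB (γ y (r + B)))).1
    linarith

theorem memHomeoPlusOrb_of_strictMono [T2Space Y] (hγ : IsFlow γ) {β : Y → ℝ} (hβ : Continuous β)
    (hm : ∀ y, StrictMono fun s => s + β (γ y s)) :
    MemHomeoPlusOrb γ fun y => γ y (β y) := by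
  have hsurj := flow_displacement_surjective hγ hβ
  have ⟨hγc, hγa, hγ0, _⟩ := hγ
  have hk : Continuous fun y => γ y (β y) := hγc.comp (continuous_id.prodMk hβ)
  have horb : ∀ y, (fun y => γ y (β y)) '' flowOrbit γ y = flowOrbit γ y := by
    intro y
    ext z
    constructor
    · rintro ⟨-, ⟨s, rfl⟩, rfl⟩
      exact ⟨s + β (γ y s), (hγa _ _ _).symm⟩
    · rintro ⟨r, rfl⟩
      obtain ⟨s, hs⟩ := hsurj y r
      exact ⟨γ y s, ⟨s, rfl⟩, by simp only [hγa]; exact congrArg (γ y) hs⟩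
  refine ⟨⟨⟨hk, fun y => by rw [horb, flowOrbit_flow hγ], fun y => ?_⟩, ?_⟩, horb⟩
  · refine ⟨1, one_pos, fun s => s + β (γ y s) - β y, ?_, ?_, by simp [hγ0], fun t _ => ?_⟩
    · exact ((continuous_id.add (hβ.comp (hγc.comp (Continuous.prodMk_right y)))).sub
        continuous_const).continuousOn
    · intro s _ t _ hst
      exact sub_lt_sub_right (hm y hst) _
    · simp only [hγa]
      congr 1
      ring
  · refine isHomeomorph_iff_continuous_bijective.2 ⟨hk, fun y z hyz => ?_, fun z => ?_⟩
    · simp only at hyz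
      have hz : z = γ y (β y - β z) := by
        rw [sub_eq_add_neg, ← hγa, hyz, hγa, add_neg_cancel, hγ0]
      have h0 : β y - β z = 0 := by
        refine (hm y).injective ?_
        simp only [← hz, hγ0]
        ring
      rw [hz, h0, hγ0]
    · have : z ∈ (fun y => γ y (β y)) '' flowOrbit γ z := by
        rw [horb]
        exact ⟨0, hγ0 z⟩
      obtain ⟨y, -, hy⟩ := this
      exact ⟨y, hy⟩

theorem memHomeoPlusIso_of_strictMono [T2Space Y] (hγ : IsFlow γ) {β : Y → ℝ} (hβ : Continuous β)
    (hm : ∀ y, StrictMono fun s => s + β (γ y s)) :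
    MemHomeoPlusIso γ fun y => γ y (β y) := by
  refine ⟨memHomeoPlusOrb_of_strictMono hγ hβ hm, fun y t => γ y (t * β y), ?_, ?_, ?_, ?_⟩
  · exact (hγ.1.comp (continuous_fst.prodMk (continuous_snd.mul
      (hβ.comp continuous_fst)))).continuousOn
  · rintro t ⟨ht0, ht1⟩
    refine (memHomeoPlusOrb_of_strictMono hγ (β := fun y => t * β y)
      (continuous_const.mul hβ) fun y => ?_).1
    intro r s hrs
    have h := hm y hrs
    simp only at h ⊢
    rcases ht0.eq_or_lt with rfl | ht0
    · simpa using hrs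
    · nlinarith [mul_lt_mul_of_pos_left h ht0,
        mul_le_mul_of_nonneg_left hrs.le (sub_nonneg.2 ht1)]
  · intro y
    simp [hγ.2.2.1]
  · intro y
    simp

/-- If the difference of two phases lifts to a real function, then one is obtained from the other
by sliding along the flow. -/
theorem exists_displacement (hγ : IsFlow γ) {p q : Y → UnitAddCircle} {a c : Y → ℝ → ℝ}
    (ha : IsPhaseCocycle γ p a) (hc : IsPhaseCocycle γ q c) {w : Y → ℝ} (hw : Continuous w)
    (hwc : ∀ y, (w y : UnitAddCircle) = q y - p y) :
    ∃ β : Y → ℝ, Continuous β ∧ (∀ y, StrictMono fun s => s + β (γ y s)) ∧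
      (∀ y, q (γ y (β y)) = p y) ∧
      ∀ y s, c y (s + β (γ y s)) = a y s - w y := by
  have hw' : ∀ y t, w (γ y t) = w y + c y t - a y t := by
    intro y t
    refine eq_of_continuous_of_coe_eq (f := fun t => w (γ y t))
      (g := fun t => w y + c y t - a y t)
      (hw.comp (hγ.1.comp (Continuous.prodMk_right y)))
      ((continuous_const.add (hc.continuous_right y)).sub (ha.continuous_right y))
      (fun t => ?_) (by simp [hγ.2.2.1, hc.zero hγ, ha.zero hγ]) t
    rw [AddCircle.coe_sub, AddCircle.coe_add, hwc, hwc, hc.coe, ha.coe]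
    abel
  choose β hβ using fun y => hc.surjective hγ y (-w y)
  have key : ∀ y s, c y (s + β (γ y s)) = a y s - w y := by
    intro y s
    rw [hc.add, hβ, hw']
    ring
  refine ⟨β, ?_, fun y s t hst => ?_, fun y => ?_, key⟩
  · refine continuous_iff_continuousAt.2 fun y => ?_
    rw [ContinuousAt, tendsto_order]
    constructor
    · intro r hr
      have h1 : c y r < -w y := by
        rw [← hβ]
        exact hc.strictMono y hr
      have hcr : Continuous fun z => c z r := hc.continuous.comp (Continuous.prodMk_left r)
      filter_upwards [(isOpen_lt hcr hw.neg).mem_nhds h1] with z hz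
      refine (hc.strictMono z).lt_iff_lt.1 ?_
      rw [hβ]
      exact hz
    · intro r hr
      have h1 : -w y < c y r := by
        rw [← hβ]
        exact hc.strictMono y hr
      have hcr : Continuous fun z => c z r := hc.continuous.comp (Continuous.prodMk_left r)
      filter_upwards [(isOpen_lt hw.neg hcr).mem_nhds h1] with z hz
      refine (hc.strictMono z).lt_iff_lt.1 ?_
      rw [hβ]
      exact hz
  · refine (hc.strictMono y).lt_iff_lt.1 ?_
    simp only [key]
    exact sub_lt_sub_right (ha.strictMono y hst) _
  · rw [hc.coe, hβ, AddCircle.coe_neg, hwc]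
    abel

end Isotopy

section CrossSection

open Filter

variable {Y : Type*} [TopologicalSpace Y] {γ : Y → ℝ → Y} {C : Set Y} {τ : C → ℝ}

lemma exists_pos_le_returnTime [CompactSpace Y] (hγ : IsFlow γ) (hC : IsCrossSection γ C)
    (hτ : ∀ x : C, IsLeast {t : ℝ | 0 < t ∧ γ (x : Y) t ∈ C} (τ x)) :
    ∃ ε > 0, ∀ x, ε ≤ τ x := by
  have : CompactSpace C := isCompact_iff_compactSpace.1 hC.1.isCompact
  suffices ∃ ε > 0, ∀ x ∈ (univ : Set C), ε ≤ τ x by simpa using this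
  refine isCompact_univ.induction_on (p := fun s => ∃ ε > 0, ∀ x ∈ s, ε ≤ τ x)
    ⟨1, one_pos, by simp⟩ ?_ ?_ ?_
  · rintro s t hst ⟨ε, hε, h⟩
    exact ⟨ε, hε, fun x hx => h x (hst hx)⟩
  · rintro s t ⟨ε, hε, h⟩ ⟨δ, hδ, h'⟩
    refine ⟨min ε δ, lt_min hε hδ, ?_⟩
    rintro x (hx | hx)
    · exact (min_le_left _ _).trans (h x hx)
    · exact (min_le_right _ _).trans (h' x hx)
  rintro x -
  obtain ⟨e, he, heq⟩ := hC.2.2 (x, 0)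
  have h1 : ∀ᶠ z in 𝓝 (x : Y), ∀ x' : C, (x' : Y) = z → (x', (0 : ℝ)) ∈ e.source := by
    rw [← eventually_comap, ← nhds_subtype_eq_comap]
    have hc : ContinuousAt (fun x' : C => (x', (0 : ℝ))) x := by fun_prop
    exact hc.eventually (e.open_source.mem_nhds he)
  have h2 : ContinuousAt (fun p : C × ℝ => γ p.1 p.2) (x, 0) :=
    (hγ.1.comp (f := fun p : C × ℝ => ((p.1 : Y), p.2)) (by fun_prop)).continuousAt
  have h3 := h2.eventually (p := fun z => ∀ x' : C, (x' : Y) = z → (x', (0 : ℝ)) ∈ e.source)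
    (by simpa only [hγ.2.2.1] using h1)
  have h4 := h3.and (e.open_source.mem_nhds he)
  rw [nhds_prod_eq, eventually_prod_iff] at h4
  obtain ⟨pa, hpa, pb, hpb, hab⟩ := h4
  obtain ⟨δ, hδ, hδb⟩ := Metric.eventually_nhds_iff.1 hpb
  refine ⟨{x' | pa x'}, mem_nhdsWithin_of_mem_nhds hpa, δ, hδ, fun x' hx' => ?_⟩
  by_contra! hlt
  obtain ⟨hpos, hret⟩ := (hτ x').1
  obtain ⟨h5, h6⟩ := hab hx' (hδb (y := τ x') (by simpa [abs_of_pos hpos] using hlt))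
  have h7 := e.injOn h6 (h5 ⟨_, hret⟩ rfl) (by simp [← heq, hγ.2.2.1])
  exact hpos.ne' (congrArg Prod.snd h7)

lemma continuous_returnTime [CompactSpace Y] (hγ : IsFlow γ) (hC : IsCrossSection γ C)
    (hτ : ∀ x : C, IsLeast {t : ℝ | 0 < t ∧ γ (x : Y) t ∈ C} (τ x)) : Continuous τ := by
  obtain ⟨ε, hε, hετ⟩ := exists_pos_le_returnTime hγ hC hτ
  have hΦ : Continuous fun p : C × ℝ => γ p.1 p.2 :=
    hγ.1.comp (f := fun p : C × ℝ => ((p.1 : Y), p.2)) (by fun_prop)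
  refine continuous_iff_continuousAt.2 fun x => ?_
  rw [ContinuousAt, tendsto_order]
  constructor
  · intro r hr
    have h1 : ∀ᶠ x' : C in 𝓝 x, ∀ t ∈ Icc (ε / 2) r, γ (x' : Y) t ∉ C := by
      refine isCompact_Icc.eventually_forall_of_forall_eventually fun t ht => ?_
      refine (hΦ.continuousAt (x := (x, t))).eventually (hC.1.isOpen_compl.mem_nhds ?_)
      intro hmem
      have := (hτ x).2 ⟨by linarith [ht.1], hmem⟩
      linarith [ht.2]
    filter_upwards [h1] with x' hx'
    by_contra! hle
    exact hx' (τ x') ⟨by linarith [hετ x'], hle⟩ (hτ x').1.2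
  · intro r hr
    obtain ⟨hpos, hret⟩ := (hτ x).1
    have hδ : 0 < min (r - τ x) (τ x) := lt_min (sub_pos.2 hr) hpos
    have hopen := hC.2.2.isOpenMap _ ((isOpen_univ (X := C)).prod
      (isOpen_Ioo (a := -min (r - τ x) (τ x)) (b := min (r - τ x) (τ x))))
    have hc : Continuous fun x' : C => γ x' (τ x) := hΦ.comp (Continuous.prodMk_left (τ x))
    have hmem : γ x (τ x) ∈ (fun p : C × ℝ => γ p.1.1 p.2) ''
        (univ ×ˢ Ioo (-min (r - τ x) (τ x)) (min (r - τ x) (τ x))) :=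
      ⟨(⟨_, hret⟩, 0), ⟨mem_univ _, by simpa using hδ⟩, hγ.2.2.1 _⟩
    filter_upwards [hc.continuousAt.eventually (hopen.mem_nhds hmem)] with x' hx'
    obtain ⟨⟨x₂, s⟩, ⟨-, hs⟩, hxs⟩ := hx'
    simp only at hs hxs
    have h2 : γ x' (τ x - s) = x₂ := by
      rw [sub_eq_add_neg, ← hγ.2.1, ← hxs, hγ.2.1, add_neg_cancel, hγ.2.2.1]
    have h3 := lt_min_iff.1 hs.2
    have h4 := hs.1
    rw [neg_lt, lt_min_iff] at h4
    have h5 := (hτ x').2 (show 0 < τ x - s ∧ γ (x' : Y) (τ x - s) ∈ C from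
      ⟨by linarith, h2 ▸ x₂.2⟩)
    linarith

lemma exists_mem_crossSection_flow_eq [CompactSpace Y] (hγ : IsFlow γ) (hC : IsCrossSection γ C)
    (hτ : ∀ x : C, IsLeast {t : ℝ | 0 < t ∧ γ (x : Y) t ∈ C} (τ x)) (y : Y) :
    ∃ (x : C) (s : ℝ), 0 ≤ s ∧ s < τ x ∧ γ x s = y := by
  obtain ⟨n, hn⟩ := isCompact_univ.elim_directed_cover
    (fun n : ℕ => (fun p : C × ℝ => γ p.1.1 p.2) '' (univ ×ˢ Ioo (-n : ℝ) n))
    (fun n => hC.2.2.isOpenMap _ (isOpen_univ.prod isOpen_Ioo))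
    (fun z _ => by
      obtain ⟨⟨x, s⟩, rfl⟩ := hC.2.1 z
      obtain ⟨n, hn⟩ := exists_nat_gt |s|
      exact mem_iUnion.2 ⟨n, (x, s), ⟨mem_univ _, abs_lt.1 hn⟩, rfl⟩)
    (Monotone.directed_le fun m n hmn => image_mono (prod_mono_right (by
      have : (m : ℝ) ≤ n := by exact_mod_cast hmn
      exact Ioo_subset_Ioo (by linarith) this)))
  obtain ⟨⟨x, s⟩, ⟨-, hs⟩, hxs⟩ := hn (mem_univ (γ y (-n)))
  simp only at hs hxs
  have hS : IsCompact (Icc (-(2 * n) : ℝ) 0 ∩ {t | γ y t ∈ C}) :=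
    isCompact_Icc.inter_right (hC.1.preimage (hγ.1.comp (Continuous.prodMk_right y)))
  have hne : (Icc (-(2 * n) : ℝ) 0 ∩ {t | γ y t ∈ C}).Nonempty := by
    refine ⟨-n - s, ⟨by linarith [hs.2], by linarith [hs.1]⟩, ?_⟩
    have : γ y (-n - s) = x := by
      rw [sub_eq_add_neg, ← hγ.2.1, ← hxs, hγ.2.1, add_neg_cancel, hγ.2.2.1]
    simp [this]
  obtain ⟨t, ⟨ht, htC⟩, hmax⟩ := hS.exists_isGreatest hne
  refine ⟨⟨γ y t, htC⟩, -t, by linarith [ht.2], ?_, by simp [hγ.2.1, hγ.2.2.1]⟩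
  by_contra! hle
  obtain ⟨hpos, hret⟩ := (hτ ⟨γ y t, htC⟩).1
  have : t + τ ⟨γ y t, htC⟩ ≤ t :=
    hmax ⟨⟨by linarith [ht.1], by linarith⟩, by rwa [hγ.2.1] at hret⟩
  linarith

/-- A function on the suspension of the return map descends to the flow space. -/
lemma exists_descend [CompactSpace Y] [T2Space Y] (hγ : IsFlow γ) (hC : IsCrossSection γ C)
    (hτ : ∀ x : C, IsLeast {t : ℝ | 0 < t ∧ γ (x : Y) t ∈ C} (τ x))
    {Z : Type*} [TopologicalSpace Z] {F : C × ℝ → Z} (hF : Continuous F)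
    (hF1 : ∀ x z : C, (z : Y) = γ x (τ x) → F (x, 1) = F (z, 0)) :
    ∃ g : Y → Z, Continuous g ∧ ∀ (x : C) (s : ℝ), 0 ≤ s → s ≤ τ x → g (γ x s) = F (x, s / τ x) := by
  have : CompactSpace C := isCompact_iff_compactSpace.1 hC.1.isCompact
  have hτc := continuous_returnTime hγ hC hτ
  have hτ0 : ∀ x, 0 < τ x := fun x => (hτ x).1.1
  let Ψ : C × unitInterval → Y := fun p => γ p.1 (p.2 * τ p.1)
  have hΨc : Continuous Ψ := hγ.1.comp (f := fun p : C × unitInterval =>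
    ((p.1 : Y), (p.2 : ℝ) * τ p.1)) (by fun_prop)
  have hΨs : Function.Surjective Ψ := by
    intro y
    obtain ⟨x, s, hs0, hs, rfl⟩ := exists_mem_crossSection_flow_eq hγ hC hτ y
    refine ⟨(x, ⟨s / τ x, div_nonneg hs0 (hτ0 x).le, (div_le_one (hτ0 x)).2 hs.le⟩), ?_⟩
    simp [Ψ, div_mul_cancel₀ _ (hτ0 x).ne']
  have hΨq : IsQuotientMap Ψ := hΨc.isClosedMap.isQuotientMap hΨc hΨs
  have hle : ∀ (x x' : C) (s s' : ℝ), 0 ≤ s → s ≤ s' → s' ≤ τ x' → γ x s = γ x' s' →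
      F (x, s / τ x) = F (x', s' / τ x') := by
    intro x x' s s' hs hss' hs' heq
    have h1 : γ x' (s' - s) = x := by
      rw [sub_eq_add_neg, ← hγ.2.1, ← heq, hγ.2.1, add_neg_cancel, hγ.2.2.1]
    rcases hss'.eq_or_lt with rfl | hlt
    · rw [sub_self, hγ.2.2.1] at h1
      rw [Subtype.ext h1]
    · have h2 := (hτ x').2 (show 0 < s' - s ∧ γ (x' : Y) (s' - s) ∈ C from
        ⟨sub_pos.2 hlt, h1 ▸ x.2⟩)
      have hs0 : s = 0 := by linarith
      have hs1 : s' = τ x' := by linarith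
      rw [hs0, hs1, div_self (hτ0 x').ne', zero_div]
      refine (hF1 _ _ ?_).symm
      rw [← h1, hs0, hs1, sub_zero]
  choose b t ht0 ht hbt using exists_mem_crossSection_flow_eq hγ hC hτ
  have hg : ∀ (x : C) (s : ℝ), 0 ≤ s → s ≤ τ x →
      F (b (γ x s), t (γ x s) / τ (b (γ x s))) = F (x, s / τ x) := by
    intro x s hs0 hs
    rcases le_total (t (γ x s)) s with h | h
    · exact hle _ _ _ _ (ht0 _) h hs (hbt _)
    · exact (hle _ _ _ _ hs0 h (ht _).le (hbt _).symm).symm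
  refine ⟨fun y => F (b y, t y / τ (b y)), hΨq.continuous_iff.2 ?_, hg⟩
  have : (fun y => F (b y, t y / τ (b y))) ∘ Ψ = fun p => F (p.1, p.2) := by
    funext ⟨x, r⟩
    rw [Function.comp_apply]
    refine (hg x (r * τ x) (mul_nonneg r.2.1 (hτ0 x).le)
      (mul_le_of_le_one_left (hτ0 x).le r.2.2)).trans ?_
    rw [mul_div_cancel_right₀ _ (hτ0 x).ne']
  rw [this]
  fun_prop

theorem exists_phase [CompactSpace Y] [T2Space Y] (hγ : IsFlow γ) (hC : IsCrossSection γ C)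
    (hτ : ∀ x : C, IsLeast {t : ℝ | 0 < t ∧ γ (x : Y) t ∈ C} (τ x)) :
    ∃ p : Y → UnitAddCircle, IsCirclePhase γ p ∧ {y | p y = 0} = C := by
  have hτ0 : ∀ x, 0 < τ x := fun x => (hτ x).1.1
  obtain ⟨p, hp, hps⟩ := exists_descend hγ hC hτ (F := fun x => ((x.2 : ℝ) : UnitAddCircle))
    ((AddCircle.continuous_mk' 1).comp continuous_snd) (by
      intro x z _
      simp)
  refine ⟨p, ⟨hp, fun y => ?_⟩, ?_⟩
  · obtain ⟨x, s, hs0, hs, rfl⟩ := exists_mem_crossSection_flow_eq hγ hC hτ y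
    refine ⟨fun t => t / τ x, ?_, ?_⟩
    · have : Tendsto (fun t => t / τ x) (𝓝 0) (𝓝 (0 / τ x)) :=
        (continuous_id.div_const _).tendsto 0
      rw [zero_div] at this
      exact this.mono_left nhdsWithin_le_nhds
    · filter_upwards [Ioc_mem_nhdsGT (sub_pos.2 hs)] with t ht
      refine ⟨div_pos ht.1 (hτ0 x), ?_⟩
      rw [hγ.2.1, hps _ _ hs0 hs.le, hps _ _ (by linarith [ht.1]) (by linarith [ht.2]), add_div,
        AddCircle.coe_add]
  · ext y
    obtain ⟨x, s, hs0, hs, rfl⟩ := exists_mem_crossSection_flow_eq hγ hC hτ y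
    rw [mem_ofPred, hps _ _ hs0 hs.le]
    constructor
    · intro h
      have h1 : s / τ x = 0 := by
        refine eq_of_coe_unitAddCircle_eq h ?_
        rw [sub_zero, abs_of_nonneg (div_nonneg hs0 (hτ0 x).le), div_lt_one (hτ0 x)]
        exact hs
      rw [div_eq_zero_iff, or_iff_left (hτ0 x).ne'] at h1
      rw [h1, hγ.2.2.1]
      exact x.2
    · intro h
      have : s = 0 := by
        by_contra hne
        linarith [(hτ x).2 ⟨hs0.lt_of_ne' hne, h⟩]
      simp [this]

/-- A phase vanishing exactly on the cross section increases by one up to the first return. -/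
lemma IsPhaseCocycle.returnTime_eq_one [CompactSpace Y] (hγ : IsFlow γ)
    (hτ : ∀ x : C, IsLeast {t : ℝ | 0 < t ∧ γ (x : Y) t ∈ C} (τ x)) {p : Y → UnitAddCircle}
    (hp : {y | p y = 0} = C) {a : Y → ℝ → ℝ} (ha : IsPhaseCocycle γ p a) (x : C) :
    a x (τ x) = 1 := by
  have hpC : ∀ y, y ∈ C ↔ p y = 0 := by simp [← hp]
  obtain ⟨hpos, hret⟩ := (hτ x).1
  have h1 := ha.coe x (τ x)
  rw [(hpC _).1 hret, (hpC _).1 x.2, zero_add, ← AddCircle.coe_zero, eq_comm,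
    coe_unitAddCircle_eq_iff] at h1
  obtain ⟨n, hn⟩ := h1
  rw [zero_add] at hn
  have h2 := ha.strictMono x hpos
  rw [ha.zero hγ, hn] at h2
  have h3 : 1 ≤ n := by
    have : 0 < n := by exact_mod_cast h2
    omega
  have h4 : (1 : ℝ) ≤ n := by exact_mod_cast h3
  refine le_antisymm ?_ (hn ▸ h4)
  by_contra! hlt
  obtain ⟨t, ht⟩ := ha.surjective hγ x 1
  have h5 : 0 < t := by
    rw [← (ha.strictMono x).lt_iff_lt, ha.zero hγ, ht]
    exact one_pos
  have h6 : t < τ x := by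
    rw [← (ha.strictMono x).lt_iff_lt, ht]
    exact hlt
  have h7 := ha.coe x t
  rw [ht, (hpC _).1 x.2, AddCircle.coe_period, zero_add] at h7
  linarith [(hτ x).2 ⟨h5, (hpC _).2 h7⟩]

end CrossSection

section Livsic

variable {A : Type*} {X : Set (ℤ → A)}

lemma IsSFT.exists_window (hX : IsSFT X) :
    ∃ L : ℕ, ∀ z : ℤ → A,
      (∀ n : ℤ, ∃ x ∈ X, ∃ j : ℤ, ∀ i : ℕ, i < L → z (n + i) = x (j + i)) → z ∈ X := by
  obtain ⟨F, hF, rfl⟩ := hX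
  obtain ⟨L, hL⟩ := (hF.image List.length).bddAbove
  refine ⟨L, fun z hz w hw n hocc => ?_⟩
  obtain ⟨x, hx, j, hj⟩ := hz n
  refine hx w hw j fun i hi => ?_
  rw [← hj i (hi.trans_le (hL ⟨w, hw, rfl⟩))]
  exact hocc i hi

/-- Birkhoff sum of `f` along the shift. -/
def shiftSum (f : (ℤ → A) → ℤ) (x : ℤ → A) (k : ℕ) : ℤ :=
  ∑ i ∈ Finset.range k, f fun n => x (n + i)

/-- Two bisequences agree on the window `[-m, m]`. -/
def AgreeOn (m : ℕ) (x y : ℤ → A) : Prop := ∀ i : ℤ, -m ≤ i → i ≤ m → x i = y i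

lemma AgreeOn.symm {m : ℕ} {x y : ℤ → A} (h : AgreeOn m x y) : AgreeOn m y x :=
  fun i h1 h2 => (h i h1 h2).symm

lemma AgreeOn.trans {m : ℕ} {x y z : ℤ → A} (h : AgreeOn m x y) (h' : AgreeOn m y z) :
    AgreeOn m x z :=
  fun i h1 h2 => (h i h1 h2).trans (h' i h1 h2)

/-- `X` is determined by windows of length at most `m`, and so are the values of `f` on `X`. -/
structure IsWindow (X : Set (ℤ → A)) (f : (ℤ → A) → ℤ) (m : ℕ) : Prop where
  mem : ∀ z : ℤ → A,
    (∀ n : ℤ, ∃ x ∈ X, ∃ j : ℤ, ∀ i : ℕ, i < m → z (n + i) = x (j + i)) → z ∈ X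
  eq : ∀ x ∈ X, ∀ y ∈ X, AgreeOn m x y → f x = f y

namespace IsWindow

variable {f : (ℤ → A) → ℤ} {m : ℕ}

lemma shift_mem (h : IsWindow X f m) {x : ℤ → A} (hx : x ∈ X) (j : ℤ) :
    (fun n => x (n + j)) ∈ X :=
  h.mem _ fun n => ⟨x, hx, n + j, fun i _ => by congr 1; ring⟩

lemma shiftSum_eq_zero_of_agreeOn (h : IsWindow X f m)
    (hper : ∀ x ∈ X, ∀ k : ℕ, 0 < k → (∀ i : ℤ, x (i + k) = x i) → shiftSum f x k = 0)
    {x : ℤ → A} (hx : x ∈ X) {k : ℕ} (hk : 0 < k) (hxk : AgreeOn m (fun i => x (i + k)) x) :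
    shiftSum f x k = 0 := by
  have hk' : (0 : ℤ) < k := by exact_mod_cast hk
  have hstep : ∀ (q : ℕ) (r : ℤ), 0 ≤ r → r + q * k ≤ 2 * m + k →
      x (-m + r + q * k) = x (-m + r) := by
    intro q
    induction q with
    | zero => intro r _ _; simp
    | succ q ih =>
      intro r hr hrq
      have hq : (0 : ℤ) ≤ q * k := by positivity
      push_cast at hrq ⊢
      rw [add_mul, one_mul] at hrq ⊢
      rw [← ih r hr (by linarith), ← hxk (-m + r + q * k) (by linarith) (by linarith)]
      simp only
      congr 1
      ring
  let z : ℤ → A := fun j => x (-m + (j + m) % k)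
  have hzx : ∀ j : ℤ, -m ≤ j → j ≤ m + k → z j = x j := by
    intro j h1 h2
    have h3 := Int.emod_add_mul_ediv (j + m) k
    have h4 : 0 ≤ (j + m) / k := Int.ediv_nonneg (by linarith) hk'.le
    obtain ⟨q, hq⟩ := Int.eq_ofNat_of_zero_le h4
    rw [hq, mul_comm] at h3
    have h5 := hstep q ((j + m) % k) (Int.emod_nonneg _ hk'.ne') (by linarith)
    rw [show (-m + (j + m) % k + q * k : ℤ) = j by linarith] at h5
    exact h5.symm
  have hzper : ∀ j j' : ℤ, (j + m) % k = (j' + m) % k → z j = z j' := fun j j' hj => by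
    simp only [z, hj]
  have hz : z ∈ X := by
    refine h.mem z fun n => ⟨x, hx, -m + (n + m) % k, fun i hi => ?_⟩
    have h1 := Int.emod_nonneg (n + m) hk'.ne'
    have h2 := Int.emod_lt_of_pos (n + m) hk'
    rw [← hzx _ (by linarith) (by have : (i : ℤ) < m := by exact_mod_cast hi
                                  linarith)]
    refine hzper _ _ ?_
    rw [show (-m + (n + m) % k + i + m : ℤ) = (n + m) % k + i by ring, Int.emod_add_emod]
    congr 1
    ring
  rw [← hper z hz k hk fun i => hzper _ _ (by
    rw [show (i + k + m : ℤ) = i + m + k by ring, Int.add_emod_right])]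
  refine Finset.sum_congr rfl fun i hi => h.eq _ (h.shift_mem hx i) _ (h.shift_mem hz i) ?_
  have hi' : (i : ℤ) < k := by exact_mod_cast Finset.mem_range.1 hi
  intro n h1 h2
  exact (hzx _ (by linarith) (by linarith)).symm

lemma exists_concat (h : IsWindow X f m) {x y : ℤ → A} (hx : x ∈ X) (hy : y ∈ X) (j k : ℕ)
    (hxy : AgreeOn m (fun i => x (i + j)) y) :
    ∃ z ∈ X, AgreeOn m z x ∧ AgreeOn m (fun i => z (i + (j + k : ℕ))) (fun i => y (i + k)) ∧
      shiftSum f z (j + k) = shiftSum f x j + shiftSum f y k := by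
  let z : ℤ → A := fun i => if i ≤ j then x i else y (i - j)
  have hzx : ∀ i : ℤ, i ≤ j + m → z i = x i := by
    intro i hi
    by_cases hij : i ≤ j
    · simp [z, hij]
    · simp only [z, hij, if_false]
      rw [← hxy (i - j) (by linarith) (by linarith)]
      simp
  have hzy : ∀ i : ℤ, j - m ≤ i → z i = y (i - j) := by
    intro i hi
    by_cases hij : i ≤ j
    · simp only [z, hij, if_true]
      rw [← hxy (i - j) (by linarith) (by linarith)]
      simp
    · simp [z, hij]
  have hz : z ∈ X := by
    refine h.mem z fun n => ?_
    by_cases hn : n ≤ j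
    · refine ⟨x, hx, n, fun i hi => hzx _ ?_⟩
      have : (i : ℤ) < m := by exact_mod_cast hi
      linarith
    · refine ⟨y, hy, n - j, fun i _ => ?_⟩
      rw [hzy _ (by linarith)]
      congr 1
      ring
  refine ⟨z, hz, fun i _ h2 => hzx i (by linarith), fun i h1 _ => ?_, ?_⟩
  · simp only
    push_cast
    rw [hzy _ (by linarith)]
    congr 1
    ring
  · unfold shiftSum
    rw [Finset.sum_range_add]
    congr 1
    · refine Finset.sum_congr rfl fun i hi => h.eq _ (h.shift_mem hz i) _ (h.shift_mem hx i) ?_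
      have hi' : (i : ℤ) < j := by exact_mod_cast Finset.mem_range.1 hi
      intro n _ h2
      exact hzx _ (by linarith)
    · refine Finset.sum_congr rfl fun i _ =>
        h.eq _ (h.shift_mem hz (j + i : ℕ)) _ (h.shift_mem hy i) ?_
      intro n h1 _
      simp only
      push_cast
      rw [hzy _ (by linarith)]
      congr 1
      ring

lemma exists_connect (h : IsWindow X f m) (hX : IsIrreducibleSubshift X) {x y : ℤ → A}
    (hx : x ∈ X) (hy : y ∈ X) :
    ∃ z ∈ X, ∃ k : ℕ, 0 < k ∧ AgreeOn m z x ∧ AgreeOn m (fun i => z (i + k)) y := by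
  have hocc : ∀ x ∈ X, wordOccursIn (List.ofFn fun i : Fin (2 * m + 1) => x (-m + i)) X :=
    fun x hx => ⟨x, hx, -m, fun i hi => by
      rw [List.get_eq_getElem, List.getElem_ofFn]⟩
  obtain ⟨w, z, hz, n, hw⟩ := hX _ _ (hocc x hx) (hocc y hy)
  refine ⟨_, h.shift_mem hz (n + m), 2 * m + 1 + w.length, by omega, fun i h1 h2 => ?_,
    fun i h1 h2 => ?_⟩
  · obtain ⟨j, hj⟩ := Int.eq_ofNat_of_zero_le (show 0 ≤ i + m by linarith)
    have := hw j (by simp; omega)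
    rw [List.get_eq_getElem, List.getElem_append_left (by simp; omega),
      List.getElem_append_left (by simp; omega), List.getElem_ofFn] at this
    simp only
    rw [show i + (n + m) = n + j by linarith, this]
    congr 1
    simp only
    linarith
  · obtain ⟨j, hj⟩ := Int.eq_ofNat_of_zero_le (show 0 ≤ i + m by linarith)
    have := hw (2 * m + 1 + w.length + j) (by simp; omega)
    rw [List.get_eq_getElem, List.getElem_append_right (by simp; omega), List.getElem_ofFn] at this
    simp only
    push_cast at this ⊢
    rw [show i + (2 * m + 1 + w.length) + (n + m) = n + (2 * m + 1 + w.length + j) by linarith,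
      this]
    congr 1
    simp only [List.length_append, List.length_ofFn]
    omega

end IsWindow

/-- Livšic's theorem for integer-valued functions on irreducible shifts of finite type: a function
depending on finitely many coordinates whose sums over periodic orbits vanish is a coboundary. -/
theorem IsSFT.exists_coboundary (hne : X.Nonempty) (hX : IsSFT X) (hirr : IsIrreducibleSubshift X)
    {f : (ℤ → A) → ℤ} {N : ℕ} (hf : ∀ x ∈ X, ∀ y ∈ X, AgreeOn N x y → f x = f y)
    (hper : ∀ x ∈ X, ∀ k : ℕ, 0 < k → (∀ i : ℤ, x (i + k) = x i) → shiftSum f x k = 0) :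
    ∃ (u : (ℤ → A) → ℤ) (m : ℕ), (∀ x ∈ X, ∀ y ∈ X, AgreeOn m x y → u x = u y) ∧
      ∀ x ∈ X, u (shiftMap x) = u x + f x := by
  obtain ⟨L, hL⟩ := hX.exists_window
  obtain ⟨m, hm⟩ : ∃ m, IsWindow X f m := by
    refine ⟨max N L, ⟨fun z hz => hL z fun n => ?_, fun x hx y hy hxy => hf x hx y hy ?_⟩⟩
    · obtain ⟨x, hx, j, hj⟩ := hz n
      exact ⟨x, hx, j, fun i hi => hj i (lt_max_of_lt_right hi)⟩
    · intro i h1 h2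
      have : (N : ℤ) ≤ (max N L : ℕ) := by exact_mod_cast le_max_left N L
      exact hxy i (by linarith) (by linarith)
  obtain ⟨x₀, hx₀⟩ := hne
  let R : (ℤ → A) → ℤ → Prop := fun y r => ∃ z ∈ X, ∃ k : ℕ, AgreeOn m z x₀ ∧
    AgreeOn m (fun i => z (i + k)) y ∧ shiftSum f z k = r
  have hRex : ∀ y, ∃ r, y ∈ X → R y r := by
    intro y
    by_cases hy : y ∈ X
    · obtain ⟨z, hz, k, -, h1, h2⟩ := hm.exists_connect hirr hx₀ hy
      exact ⟨_, fun _ => ⟨z, hz, k, h1, h2, rfl⟩⟩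
    · exact ⟨0, fun h => absurd h hy⟩
  have hRuniq : ∀ y ∈ X, ∀ r r', R y r → R y r' → r = r' := by
    intro y hy
    obtain ⟨w, hw, l, hl, hwy, hwx⟩ := hm.exists_connect hirr hy hx₀
    have : ∀ r, R y r → r = -shiftSum f w l := by
      rintro r ⟨z, hz, k, hzx, hzy, rfl⟩
      obtain ⟨v, hv, hvz, hvw, hsum⟩ := hm.exists_concat hz hw k l (hzy.trans hwy.symm)
      have := hm.shiftSum_eq_zero_of_agreeOn hper hv (by omega : 0 < k + l)
        ((hvw.trans hwx).trans (hvz.trans hzx).symm)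
      linarith
    intro r r' h1 h2
    rw [this r h1, this r' h2]
  choose u hu using hRex
  refine ⟨u, m, fun x hx y hy hxy => ?_, fun x hx => ?_⟩
  · obtain ⟨z, hz, k, h1, h2, h3⟩ := hu x hx
    exact hRuniq y hy _ _ ⟨z, hz, k, h1, h2.trans hxy, h3⟩ (hu y hy)
  · obtain ⟨z, hz, k, h1, h2, h3⟩ := hu x hx
    obtain ⟨v, hv, hvz, hvx, hsum⟩ := hm.exists_concat hz hx k 1 h2
    have hs : shiftMap x ∈ X := hm.shift_mem hx 1
    refine hRuniq _ hs _ _ (hu _ hs) ⟨v, hv, k + 1, hvz.trans h1, hvx, ?_⟩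
    rw [hsum, h3]
    simp [shiftSum]

end Livsic

section FlowMap

open Filter

variable {Y Y' : Type*} [TopologicalSpace Y] [TopologicalSpace Y']
  {γ : Y → ℝ → Y} {γ' : Y' → ℝ → Y'} {h : Y → Y'}

lemma IsFlowMap.exists_local_time (hh : IsFlowMap γ γ' h) (y : Y) :
    ∃ c : ℝ → ℝ, Tendsto c (𝓝[>] 0) (𝓝[>] 0) ∧
      ∀ᶠ t in 𝓝[>] 0, h (γ y t) = γ' (h y) (c t) := by
  obtain ⟨ε, hε, c, hc, hm, hc0, hloc⟩ := hh.2.2 y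
  have h0 : (0 : ℝ) ∈ Ioo (-ε) ε := ⟨by linarith, hε⟩
  have hnhds : Ioo (-ε) ε ∈ 𝓝 (0 : ℝ) := Ioo_mem_nhds h0.1 h0.2
  refine ⟨c, tendsto_nhdsWithin_iff.2 ⟨?_, ?_⟩, ?_⟩
  · have := (hc.continuousAt hnhds).tendsto
    rw [hc0] at this
    exact this.mono_left nhdsWithin_le_nhds
  · filter_upwards [nhdsWithin_le_nhds hnhds, self_mem_nhdsWithin] with t ht ht0
    have := hm h0 ht ht0
    rwa [hc0] at this
  · filter_upwards [nhdsWithin_le_nhds hnhds] with t ht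
    exact hloc t (abs_lt.2 ht)

lemma IsCirclePhase.comp_flowMap {p' : Y' → UnitAddCircle} (hp' : IsCirclePhase γ' p')
    (hh : IsFlowMap γ γ' h) : IsCirclePhase γ fun y => p' (h y) := by
  refine ⟨hp'.1.comp hh.1, fun y => ?_⟩
  obtain ⟨c, hc, hloc⟩ := hh.exists_local_time y
  obtain ⟨e, he, hpos⟩ := hp'.2 (h y)
  refine ⟨fun t => e (c t), he.comp hc, ?_⟩
  filter_upwards [hloc, hc.eventually hpos] with t ht1 ht2
  rw [ht1]
  exact ht2

/-- A flow map sends the point reached at time `t` to the point whose phase has advanced by the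
same amount. -/
lemma IsFlowMap.exists_time_eq [CompactSpace Y'] [T2Space Y'] (hγ : IsFlow γ) (hγ' : IsFlow γ')
    (hh : IsFlowMap γ γ' h) {p' : Y' → UnitAddCircle} {a' : Y' → ℝ → ℝ} {c : Y → ℝ → ℝ}
    (ha : IsPhaseCocycle γ' p' a') (hc : IsPhaseCocycle γ (fun y => p' (h y)) c) (y : Y) {t : ℝ}
    (ht : 0 ≤ t) : ∃ s, h (γ y t) = γ' (h y) s ∧ a' (h y) s = c y t := by
  let E := (ha.strictMono (h y)).orderIsoOfSurjective _ (ha.surjective hγ' (h y))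
  have hE : ∀ s, a' (h y) (E.symm s) = s := fun s => E.apply_symm_apply s
  have hE' : ∀ s, E.symm (a' (h y) s) = s := fun s => E.symm_apply_apply s
  suffices hsub : Icc 0 t ⊆ {r | h (γ y r) = γ' (h y) (E.symm (c y r))} from
    ⟨_, hsub (right_mem_Icc.2 ht), hE _⟩
  refine IsClosed.Icc_subset_of_forall_exists_gt (IsClosed.inter ?_ isClosed_Icc) ?_ ?_
  · refine isClosed_eq (hh.1.comp (hγ.1.comp (Continuous.prodMk_right y))) ?_
    exact (hγ'.1.comp (Continuous.prodMk_right (h y))).comp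
      (E.symm.continuous.comp (hc.continuous_right y))
  · have : E.symm 0 = 0 := by rw [← ha.zero hγ' (h y), hE', ha.zero hγ']
    show h (γ y 0) = γ' (h y) (E.symm (c y 0))
    rw [hγ.2.2.1, hc.zero hγ, this, hγ'.2.2.1]
  · rintro r ⟨hr, hr0, -⟩ b hb
    replace hr : h (γ y r) = γ' (h y) (E.symm (c y r)) := hr
    obtain ⟨l, hl, hloc⟩ := hh.exists_local_time (γ y r)
    have hl' : Tendsto l (𝓝[>] 0) (𝓝 0) := hl.mono_right nhdsWithin_le_nhds
    have h1 : Tendsto (fun t => a' (h (γ y r)) (l t) - c (γ y r) t) (𝓝[>] 0) (𝓝 0) := by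
      have h2 := ((ha.continuous_right (h (γ y r))).tendsto 0).comp hl'
      have h3 := ((hc.continuous_right (γ y r)).tendsto 0).mono_left
        (nhdsWithin_le_nhds (s := Ioi 0))
      have := h2.sub h3
      rwa [ha.zero hγ', hc.zero hγ, sub_zero] at this
    have h4 : ∀ᶠ t in 𝓝[>] (0 : ℝ), |a' (h (γ y r)) (l t) - c (γ y r) t| < 1 := by
      have := h1.abs
      rw [abs_zero] at this
      exact this.eventually_lt_const one_pos
    have h5 : ∀ᶠ t in 𝓝[>] (0 : ℝ), t ∈ Ioo 0 (b - r) := Ioo_mem_nhdsGT (sub_pos.2 (mem_Ioi.1 hb))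
    obtain ⟨t, ht1, ht2, ht3⟩ := (hloc.and (h4.and h5)).exists
    refine ⟨r + t, ?_, by linarith [ht3.1], by linarith [ht3.2]⟩
    have hcoe : a' (h (γ y r)) (l t) = c (γ y r) t := by
      refine eq_of_coe_unitAddCircle_eq ?_ ht2
      have e1 := ha.coe (h (γ y r)) (l t)
      rw [← ht1, hc.coe (γ y r) t] at e1
      exact (add_left_cancel e1).symm
    show h (γ y (r + t)) = γ' (h y) (E.symm (c y (r + t)))
    have e2 : E.symm (c y (r + t)) = E.symm (c y r) + l t := by
      rw [← hE' (E.symm (c y r) + l t), ha.add, hE, ← hr, hcoe, hc.add]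
    rw [← hγ.2.1, ht1, e2, hr, hγ'.2.1]

end FlowMap

section SubshiftModel

variable {A : Type*} [TopologicalSpace A] {X : Set (ℤ → A)}

lemma exists_agreeOn_nhds (x : ℤ → A) {U : Set (ℤ → A)} (hU : U ∈ 𝓝 x) :
    ∃ m : ℕ, ∀ y, AgreeOn m x y → y ∈ U := by
  rw [nhds_pi, Filter.mem_pi] at hU
  obtain ⟨I, hI, t, ht, hsub⟩ := hU
  obtain ⟨m, hm⟩ := (hI.image Int.natAbs).bddAbove
  refine ⟨m, fun y hy => hsub fun i hi => ?_⟩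
  have : i.natAbs ≤ m := hm ⟨i, hi, rfl⟩
  rw [← hy i (by omega) (by omega)]
  exact mem_of_mem_nhds (ht i)

lemma isOpen_agreeOn [DiscreteTopology A] (m : ℕ) (x : ℤ → A) : IsOpen {y | AgreeOn m x y} := by
  have : {y | AgreeOn m x y} = ⋂ i ∈ Icc (-m : ℤ) m, {y | x i = y i} := by
    ext y
    simp [AgreeOn]
  rw [this]
  exact (finite_Icc _ _).isOpen_biInter fun i _ =>
    (isOpen_discrete {a | x i = a}).preimage (continuous_apply i)

/-- A continuous function on a subshift with values in a discrete space depends on finitely many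
coordinates. -/
lemma exists_forall_agreeOn_eq [Finite A] [DiscreteTopology A] (hX : IsClosed X) {Z : Type*}
    [TopologicalSpace Z] [DiscreteTopology Z] {f : X → Z} (hf : Continuous f) :
    ∃ N : ℕ, ∀ x y : X, AgreeOn N (x : ℤ → A) y → f x = f y := by
  have : CompactSpace X := isCompact_iff_compactSpace.1 hX.isCompact
  suffices ∃ N : ℕ, ∀ x ∈ (univ : Set X), ∀ y : X, AgreeOn N (x : ℤ → A) y → f x = f y by
    simpa using this
  refine isCompact_univ.induction_on
    (p := fun s => ∃ N : ℕ, ∀ x : X, x ∈ s → ∀ y : X, AgreeOn N (x : ℤ → A) y → f x = f y)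
    ⟨0, by simp⟩ (fun s t hst ⟨N, hN⟩ => ⟨N, fun x hx => hN x (hst hx)⟩) ?_ ?_
  · rintro s t ⟨N, hN⟩ ⟨M, hM⟩
    refine ⟨max N M, fun x hx y hxy => ?_⟩
    rcases hx with hx | hx
    · exact hN x hx y fun i _ _ => hxy i (by push_cast; omega) (by push_cast; omega)
    · exact hM x hx y fun i _ _ => hxy i (by push_cast; omega) (by push_cast; omega)
  · intro x _
    have hU : f ⁻¹' {f x} ∈ 𝓝 x := ((isOpen_discrete _).preimage hf).mem_nhds rfl
    obtain ⟨V, hV, hVU⟩ := (mem_nhds_subtype X x _).1 hU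
    obtain ⟨m, hm⟩ := exists_agreeOn_nhds (x : ℤ → A) hV
    refine ⟨{y : X | AgreeOn m (x : ℤ → A) y}, mem_nhdsWithin_of_mem_nhds
      (((isOpen_agreeOn m (x : ℤ → A)).preimage continuous_subtype_val).mem_nhds
        fun i _ _ => rfl), m, fun y hy z hyz => ?_⟩
    have h1 : f y = f x := hVU (hm _ hy)
    have h2 : f z = f x := hVU (hm _ (AgreeOn.trans hy hyz))
    rw [h1, h2]

/-- Livšic's theorem for integer-valued continuous functions on a space conjugate to an irreducible
shift of finite type. -/
theorem exists_continuous_coboundary [Finite A] [DiscreteTopology A] {S : Type*}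
    [TopologicalSpace S] {ρ : S → S} (hsub : IsSubshift X) (hSFT : IsSFT X) (hirr : IsIrreducibleSubshift X) {φ : S → X}
    (hφ : IsHomeomorph φ) (hconj : ∀ x, (φ (ρ x) : ℤ → A) = shiftMap (φ x : ℤ → A))
    {f : S → ℤ} (hf : Continuous f)
    (hper : ∀ x k, 0 < k → ρ^[k] x = x → ∑ i ∈ Finset.range k, f (ρ^[i] x) = 0) :
    ∃ u : S → ℤ, Continuous u ∧ ∀ x, u (ρ x) = u x + f x := by
  classical
  let Φ := hφ.homeomorph
  let F : (ℤ → A) → ℤ := fun z => if hz : z ∈ X then f (Φ.symm ⟨z, hz⟩) else 0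
  have hF : ∀ s : S, F (φ s) = f s := fun s => by
    have : Φ.symm (φ s) = s := Φ.symm_apply_apply s
    simp [F, this]
  have hiter : ∀ (i : ℕ) (s : S), (φ (ρ^[i] s) : ℤ → A) = fun n => (φ s : ℤ → A) (n + i) := by
    intro i s
    induction i with
    | zero => simp
    | succ i ih =>
      rw [Function.iterate_succ_apply', hconj, ih]
      funext n
      exact congrArg (φ s : ℤ → A) (by push_cast; ring)
  obtain ⟨N, hN⟩ := exists_forall_agreeOn_eq hsub.2.1 (hf.comp Φ.symm.continuous)
  obtain ⟨u, m, hu, hcob⟩ := hSFT.exists_coboundary hsub.1 hirr (f := F) (N := N)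
    (fun x hx y hy hxy => by
      have := hN ⟨x, hx⟩ ⟨y, hy⟩ hxy
      simpa [F, hx, hy] using this)
    (fun x hx k hk hxk => by
      obtain ⟨s, hs⟩ := hφ.surjective ⟨x, hx⟩
      have hs' : (φ s : ℤ → A) = x := by rw [hs]
      have hks : ρ^[k] s = s := by
        refine hφ.injective (Subtype.ext ?_)
        rw [hiter, hs']
        exact funext hxk
      rw [← hper s k hk hks]
      refine Finset.sum_congr rfl fun i _ => ?_
      rw [← hF, hiter, hs'])
  refine ⟨fun s => u (φ s), ?_, fun s => ?_⟩
  · refine continuous_iff_continuousAt.2 fun s =>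
      ContinuousAt.congr (f := fun _ => u (φ s)) continuousAt_const ?_
    have : {t : S | AgreeOn m (φ s : ℤ → A) (φ t)} ∈ 𝓝 s :=
      ((isOpen_agreeOn m (φ s : ℤ → A)).preimage
        (continuous_subtype_val.comp hφ.continuous)).mem_nhds fun i _ _ => rfl
    filter_upwards [this] with t ht
    exact hu _ (φ s).2 _ (φ t).2 ht
  · simp only
    rw [hconj, hcob _ (φ s).2, hF]

lemma exists_continuous_lift_circle {S : Type*} [TopologicalSpace S] [CompactSpace S] [T2Space S]
    [TotallyDisconnectedSpace S] {q : S → UnitAddCircle} (hq : Continuous q) :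
    ∃ v : S → ℝ, Continuous v ∧ ∀ x, (v x : UnitAddCircle) = q x := by
  classical
  have hne : ((1 / 2 : ℝ) : UnitAddCircle) ≠ ((0 : ℝ) : UnitAddCircle) := by
    intro h
    have := eq_of_coe_unitAddCircle_eq h (by norm_num)
    norm_num at this
  obtain ⟨U, hU, h0, h1⟩ := exists_clopen_of_closed_subset_open
    (isClosed_singleton (x := ((0 : ℝ) : UnitAddCircle)) |>.preimage hq)
    (isOpen_compl_singleton (x := ((1 / 2 : ℝ) : UnitAddCircle)) |>.preimage hq)
    (fun x hx hx' => hne (by rw [← (hx : q x = _), ← (hx' : q x = _)]))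
  have hhalf : ((-1 / 2 : ℝ) : UnitAddCircle) = ((1 / 2 : ℝ) : UnitAddCircle) :=
    coe_unitAddCircle_eq_iff.2 ⟨-1, by norm_num⟩
  refine ⟨fun x => if x ∈ U then (AddCircle.equivIco 1 (-1 / 2) (q x) : ℝ)
    else (AddCircle.equivIco 1 0 (q x) : ℝ), ?_, fun x => ?_⟩
  · refine continuous_iff_continuousAt.2 fun x => ?_
    by_cases hx : x ∈ U
    · have : ContinuousAt (fun x => (AddCircle.equivIco 1 (-1 / 2) (q x) : ℝ)) x :=
        continuous_subtype_val.continuousAt.comp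
          ((AddCircle.continuousAt_equivIco 1 (-1 / 2) (by rw [hhalf]; exact h1 hx)).comp
            hq.continuousAt)
      refine this.congr ?_
      filter_upwards [hU.isOpen.mem_nhds hx] with z hz
      simp [hz]
    · have : ContinuousAt (fun x => (AddCircle.equivIco 1 0 (q x) : ℝ)) x :=
        continuous_subtype_val.continuousAt.comp
          ((AddCircle.continuousAt_equivIco 1 0 fun h => hx (h0 h)).comp hq.continuousAt)
      refine this.congr ?_
      filter_upwards [hU.compl.isOpen.mem_nhds hx] with z hz
      simp [show z ∉ U from hz]
  · simp only
    split_ifs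
    · exact AddCircle.coe_equivIco
    · exact AddCircle.coe_equivIco

end SubshiftModel

section Transfer

variable {Y : Type*} [TopologicalSpace Y] {γ : Y → ℝ → Y} {C : Set Y} {τ : C → ℝ} {ρ : C → C}

lemma exists_time_iterate_return [CompactSpace Y] (hγ : IsFlow γ)
    (hτ : ∀ x : C, IsLeast {t : ℝ | 0 < t ∧ γ (x : Y) t ∈ C} (τ x))
    (hρ : ∀ x : C, (ρ x : Y) = γ (x : Y) (τ x)) {p q : Y → UnitAddCircle} (hp : {y | p y = 0} = C)
    {a c : Y → ℝ → ℝ} (ha : IsPhaseCocycle γ p a) (hc : IsPhaseCocycle γ q c) {v : C → ℝ}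
    {n : C → ℤ} (hn : ∀ x, (n x : ℝ) = v x + c x (τ x) - v (ρ x) - 1) (x : C) (k : ℕ) :
    ∃ T : ℝ, (ρ^[k] x : Y) = γ x T ∧ a x T = k ∧
      ((∑ i ∈ Finset.range k, n (ρ^[i] x) : ℤ) : ℝ) = v x + c x T - v (ρ^[k] x) - k := by
  induction k with
  | zero =>
    refine ⟨0, (hγ.2.2.1 _).symm, ?_, ?_⟩
    · simp [ha.zero hγ]
    · simp [hc.zero hγ]
  | succ k ih =>
    obtain ⟨T, h1, h2, h3⟩ := ih
    refine ⟨T + τ (ρ^[k] x), ?_, ?_, ?_⟩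
    · rw [Function.iterate_succ_apply', hρ, ← hγ.2.1, ← h1]
    · rw [ha.add, ← h1, h2, ha.returnTime_eq_one hγ hτ hp]
      push_cast
      rfl
    · rw [Finset.sum_range_succ, Function.iterate_succ_apply', Int.cast_add, h3, hn, hc.add, ← h1]
      push_cast
      ring

/-- If two phases have the same number of zeros on each closed orbit and the zero set of the first
has a return map conjugate to an irreducible shift of finite type, then their difference lifts
continuously to the real line. -/
theorem exists_lift_phase_sub [CompactSpace Y] [T2Space Y] (hγ : IsFlow γ)
    (hC : IsCrossSection γ C)
    (hτ : ∀ x : C, IsLeast {t : ℝ | 0 < t ∧ γ (x : Y) t ∈ C} (τ x))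
    (hρ : ∀ x : C, (ρ x : Y) = γ (x : Y) (τ x)) {A : Type*} [Finite A] [TopologicalSpace A]
    [DiscreteTopology A] {X : Set (ℤ → A)} (hsub : IsSubshift X) (hSFT : IsSFT X)
    (hirr : IsIrreducibleSubshift X) {φ : C → X} (hφ : IsHomeomorph φ)
    (hconj : ∀ x, (φ (ρ x) : ℤ → A) = shiftMap (φ x : ℤ → A))
    {p q : Y → UnitAddCircle} (hp : {y | p y = 0} = C) (hq : Continuous q) {a c : Y → ℝ → ℝ}
    (ha : IsPhaseCocycle γ p a) (hc : IsPhaseCocycle γ q c)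
    (hcard : ∀ y, (∃ t > (0 : ℝ), γ y t = y) →
      (flowOrbit γ y ∩ C).ncard = (flowOrbit γ y ∩ {z | q z = 0}).ncard) :
    ∃ w : Y → ℝ, Continuous w ∧ ∀ y, (w y : UnitAddCircle) = q y - p y := by
  have : CompactSpace C := isCompact_iff_compactSpace.1 hC.1.isCompact
  have : TotallyDisconnectedSpace C := hφ.homeomorph.symm.totallyDisconnectedSpace
  have hp0 : ∀ x : C, p x = 0 := fun x => by
    have : (x : Y) ∈ {y | p y = 0} := hp ▸ x.2
    exact this
  have hτc : Continuous τ := continuous_returnTime hγ hC hτ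
  have hτ0 : ∀ x, 0 < τ x := fun x => (hτ x).1.1
  have hρc : Continuous ρ := by
    refine Continuous.subtype_mk (f := fun x : C => γ x (τ x))
      (hγ.1.comp (continuous_subtype_val.prodMk hτc)) (fun x => (hτ x).1.2) |>.congr fun x => ?_
    exact Subtype.ext (hρ x).symm
  obtain ⟨v, hv, hvq⟩ := exists_continuous_lift_circle
    (hq.comp (continuous_subtype_val (p := (· ∈ C))))
  have h_int : ∀ x : C, ∃ n : ℤ, (n : ℝ) = v x + c x (τ x) - v (ρ x) - 1 := by
    intro x
    have h1 : ((v x + c x (τ x) : ℝ) : UnitAddCircle) = (v (ρ x) : ℝ) := by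
      rw [AddCircle.coe_add, hvq, hvq, Function.comp, Function.comp, hρ, hc.coe]
    obtain ⟨n, hn⟩ := coe_unitAddCircle_eq_iff.1 h1
    exact ⟨n - 1, by push_cast; linarith⟩
  choose n hn using h_int
  have hnc : Continuous n := by
    rw [Int.isClosedEmbedding_coe_real.isInducing.continuous_iff]
    have : Continuous fun x : C => v x + c x (τ x) - v (ρ x) - 1 :=
      ((hv.add (hc.continuous.comp (continuous_subtype_val.prodMk hτc))).sub
        (hv.comp hρc)).sub continuous_const
    exact this.congr fun x => (hn x).symm
  obtain ⟨u, hu, hcob⟩ := exists_continuous_coboundary hsub hSFT hirr hφ hconj hnc (by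
    intro x k hk hxk
    obtain ⟨T, h1, h2, h3⟩ := exists_time_iterate_return hγ hτ hρ hp ha hc hn x k
    rw [hxk] at h1 h3
    have hT : 0 < T := by
      rw [← (ha.strictMono x).lt_iff_lt, ha.zero hγ, h2]
      exact_mod_cast hk
    have h4 := ha.period_eq hγ hc (by rw [hp]; exact hcard x ⟨T, hT, h1.symm⟩) hT h1.symm
    rw [h4, h2] at h3
    have : ((∑ i ∈ Finset.range k, n (ρ^[i] x) : ℤ) : ℝ) = 0 := by rw [h3]; ring
    exact_mod_cast this)
  have hFc : Continuous fun z : C × ℝ =>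
      v z.1 + u z.1 + c z.1 (z.2 * τ z.1) - a z.1 (z.2 * τ z.1) := by
    have hpt : Continuous fun z : C × ℝ => ((z.1 : Y), z.2 * τ z.1) :=
      (continuous_subtype_val.comp continuous_fst).prodMk
        (continuous_snd.mul (hτc.comp continuous_fst))
    have hur : Continuous fun x => (u x : ℝ) := Int.isClosedEmbedding_coe_real.continuous.comp hu
    exact (((hv.comp continuous_fst).add (hur.comp continuous_fst)).add
      (hc.continuous.comp hpt)).sub (ha.continuous.comp hpt)
  obtain ⟨w, hw, hwF⟩ := exists_descend hγ hC hτ hFc (by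
    intro x z hz
    obtain rfl : z = ρ x := Subtype.ext (by rw [hz, hρ])
    simp only [one_mul, zero_mul]
    rw [ha.zero hγ, hc.zero hγ, ha.returnTime_eq_one hγ hτ hp, hcob]
    push_cast
    rw [hn]
    ring)
  refine ⟨w, hw, fun y => ?_⟩
  obtain ⟨x, s, hs0, hs1, rfl⟩ := exists_mem_crossSection_flow_eq hγ hC hτ y
  rw [hwF x s hs0 hs1.le]
  simp only [div_mul_cancel₀ s (hτ0 x).ne']
  have hui : ((u x : ℝ) : UnitAddCircle) = 0 := by
    rw [← AddCircle.coe_zero, coe_unitAddCircle_eq_iff]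
    exact ⟨u x, by simp⟩
  rw [AddCircle.coe_sub, AddCircle.coe_add, AddCircle.coe_add, hui, hvq, hc.coe, ha.coe, hp0]
  simp

end Transfer

/-- Theorem 6.3 of the paper: a flow equivalence between flows with cross sections whose
return maps are conjugate to irreducible SFTs, which preserves the number of intersections
of each closed orbit with the cross sections, is isotopic to a flow equivalence induced by a
topological conjugacy of the return maps. -/
theorem flow_equivalence_induced_by_conjugacy {Y Y' : Type*}
    [MetricSpace Y] [CompactSpace Y] [MetricSpace Y'] [CompactSpace Y']
    {A A' : Type*} [Finite A] [TopologicalSpace A] [DiscreteTopology A]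
    [Finite A'] [TopologicalSpace A'] [DiscreteTopology A']
    (γ : Y → ℝ → Y) (γ' : Y' → ℝ → Y') (hγ : IsFlow γ) (hγ' : IsFlow γ')
    (C : Set Y) (C' : Set Y') (hC : IsCrossSection γ C) (hC' : IsCrossSection γ' C')
    (τC : C → ℝ) (hτC : ∀ x : C, IsLeast {t : ℝ | 0 < t ∧ γ (x : Y) t ∈ C} (τC x))
    (ρC : C → C) (hρC : ∀ x : C, (ρC x : Y) = γ (x : Y) (τC x))
    (τC' : C' → ℝ) (hτC' : ∀ x : C', IsLeast {t : ℝ | 0 < t ∧ γ' (x : Y') t ∈ C'} (τC' x))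
    (ρC' : C' → C') (hρC' : ∀ x : C', (ρC' x : Y') = γ' (x : Y') (τC' x))
    -- the return map of `C` is topologically conjugate to an irreducible SFT `X`
    (X : Set (ℤ → A)) (hXsub : IsSubshift X) (hXSFT : IsSFT X)
    (hXirr : IsIrreducibleSubshift X)
    (φ : C → X) (hφ : IsHomeomorph φ)
    (hφconj : ∀ x : C, ((φ (ρC x) : ℤ → A)) = shiftMap ((φ x : ℤ → A)))
    -- the return map of `C'` is topologically conjugate to an irreducible SFT `X'`
    (X' : Set (ℤ → A')) (hX'sub : IsSubshift X') (hX'SFT : IsSFT X')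
    (hX'irr : IsIrreducibleSubshift X')
    (φ' : C' → X') (hφ' : IsHomeomorph φ')
    (hφ'conj : ∀ x : C', ((φ' (ρC' x) : ℤ → A')) = shiftMap ((φ' x : ℤ → A')))
    -- `h` is a flow equivalence preserving intersection counts of closed orbits
    (h : Y → Y') (hh : IsFlowMap γ γ' h) (hhomeo : IsHomeomorph h)
    (hcirc : ∀ y : Y, (∃ t > (0:ℝ), γ y t = y) →
      (flowOrbit γ y ∩ C).ncard = (h '' flowOrbit γ y ∩ C').ncard) :
    ∃ k : Y → Y, MemHomeoPlusIso γ k ∧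
      (h ∘ k) ⁻¹' C' = C ∧ (h ∘ k) '' C = C' ∧
      ∀ (x : C) (hx : (h ∘ k) (x : Y) ∈ C'),
        (h ∘ k) ((ρC x : C) : Y) = ((ρC' ⟨(h ∘ k) (x : Y), hx⟩ : C') : Y') := by
  obtain ⟨p, hpp, hp⟩ := exists_phase hγ hC hτC
  obtain ⟨p', hpp', hp'⟩ := exists_phase hγ' hC' hτC'
  have hpC : ∀ y, p y = 0 ↔ y ∈ C := fun y => Set.ext_iff.1 hp y
  have hpC' : ∀ y, p' y = 0 ↔ y ∈ C' := fun y => Set.ext_iff.1 hp' y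
  obtain ⟨a, ha⟩ := hpp.exists_cocycle hγ
  obtain ⟨a', ha'⟩ := hpp'.exists_cocycle hγ'
  have hq : IsCirclePhase γ fun y => p' (h y) := hpp'.comp_flowMap hh
  obtain ⟨c, hc⟩ := hq.exists_cocycle hγ
  obtain ⟨w, hw, hwc⟩ := exists_lift_phase_sub hγ hC hτC hρC hXsub hXSFT hXirr hφ hφconj hp hq.1
    ha hc (by
      intro y hy
      rw [hcirc y hy, ← Set.ncard_image_of_injective _ hhomeo.injective]
      congr 1
      ext z
      constructor
      · rintro ⟨⟨x, hx, rfl⟩, hz⟩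
        exact ⟨x, ⟨hx, (hpC' _).2 hz⟩, rfl⟩
      · rintro ⟨x, ⟨hx, hz⟩, rfl⟩
        exact ⟨⟨x, hx, rfl⟩, (hpC' _).1 hz⟩)
  obtain ⟨β, hβ, hm, hβp, hβc⟩ := exists_displacement hγ ha hc hw hwc
  have hiso := memHomeoPlusIso_of_strictMono hγ hβ hm
  have hpre : (h ∘ fun y => γ y (β y)) ⁻¹' C' = C := by
    ext y
    rw [Set.mem_preimage, ← hpC', ← hpC, Function.comp, hβp]
  refine ⟨_, hiso, hpre, ?_, fun x hx => ?_⟩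
  · rw [← hpre]
    exact Set.image_preimage_eq _ (hhomeo.surjective.comp hiso.1.1.2.surjective)
  · have hτ := hτC' ⟨_, hx⟩
    have hlt : 0 + β (γ x 0) < τC x + β (γ x (τC x)) := hm x (hτC x).1.1
    rw [zero_add, hγ.2.2.1] at hlt
    have hadv : c (γ x (β x)) (τC x + β (γ x (τC x)) - β x) = 1 := by
      have h1 := hc.add x (β x) (τC x + β (γ x (τC x)) - β x)
      have h2 := hβc x 0
      rw [zero_add, hγ.2.2.1, ha.zero hγ] at h2
      rw [add_sub_cancel, hβc, ha.returnTime_eq_one hγ hτC hp] at h1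
      linarith
    have hkρ : γ (ρC x) (β (ρC x)) = γ (γ x (β x)) (τC x + β (γ x (τC x)) - β x) := by
      rw [hρC, hγ.2.1, hγ.2.1, add_sub_cancel]
    obtain ⟨s, hs1, hs2⟩ := hh.exists_time_eq hγ hγ' ha' hc (γ x (β x)) (sub_nonneg.2 hlt.le)
    rw [hadv] at hs2
    have hone := ha'.returnTime_eq_one hγ' hτC' hp' ⟨_, hx⟩
    have hs : s = τC' ⟨_, hx⟩ := (ha'.strictMono _).injective (hs2.trans hone.symm)
    rw [hρC', ← hs]
    simp only [Function.comp]
    rw [hkρ, hs1]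
end

section
/- For i = 1,2 let T_i : X_i → X_i be a homeomorphism of a compact totally disconnected metric space, let 𝕊X_i be its mapping torus with suspension flow γ_i, and let π_i : X_i × ℝ → 𝕊X_i be the quotient map (x,t) ↦ [x,t]. Let h : 𝕊X₁ → 𝕊X₂ be a flow equivalence. Then the following are equivalent: (1) there exist j ∈ Homeo₊ⁱˢᵒ(𝕊X₁) and a homeomorphism φ : X₁ → X₂ with φ ∘ T₁ = T₂ ∘ φ such that (h ∘ j)([x,t]) = [φ(x), t] for all x ∈ X₁ and t ∈ ℝ; (2) there is a homeomorphism h̃ : X₁ × ℝ → X₂ × ℝ such that h ∘ π₁ = π₂ ∘ h̃. -/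
open Set Topology

section DeckTransformations

variable {X X₁ X₂ Y Y₁ Y₂ : Type*} [TopologicalSpace X] [TopologicalSpace X₁]
  [TopologicalSpace X₂] [TopologicalSpace Y] [TopologicalSpace Y₁] [TopologicalSpace Y₂]

/-- The deck transformation `(x, t) ↦ (T ^ n x, t - n)` of `X × ℝ` over the mapping torus. -/
def deck (T : X ≃ₜ X) (n : ℤ) (p : X × ℝ) : X × ℝ := ((T.toEquiv ^ n) p.1, p.2 - n)

@[simp] lemma deck_snd (T : X ≃ₜ X) (n : ℤ) (p : X × ℝ) : (deck T n p).2 = p.2 - n := rfl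

@[simp] lemma deck_zero (T : X ≃ₜ X) (p : X × ℝ) : deck T 0 p = p := by simp [deck]

lemma deck_deck (T : X ≃ₜ X) (m n : ℤ) (p : X × ℝ) : deck T m (deck T n p) = deck T (m + n) p := by
  ext
  · simp [deck, zpow_add]
  · simp [deck]; ring

lemma deck_injective_left (T : X ≃ₜ X) (p : X × ℝ) {m n : ℤ} (hmn : deck T m p = deck T n p) :
    m = n := by
  have := congrArg Prod.snd hmn
  simpa using this

lemma continuous_zpow_toEquiv (T : X ≃ₜ X) (n : ℤ) : Continuous (T.toEquiv ^ n : X ≃ X) := by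
  have key : ∀ m : ℕ, Continuous (T.toEquiv ^ m : X ≃ X) ∧
      Continuous ((T.toEquiv ^ m)⁻¹ : X ≃ X) := by
    intro m
    induction m with
    | zero => exact ⟨continuous_id, continuous_id⟩
    | succ m ih =>
      refine ⟨?_, ?_⟩
      · rw [pow_succ]; exact ih.1.comp T.continuous
      · rw [pow_succ, mul_inv_rev]; exact T.symm.continuous.comp ih.2
  obtain ⟨m, rfl | rfl⟩ := n.eq_nat_or_neg
  · simpa using (key m).1
  · simpa using (key m).2

lemma continuous_deck (T : X ≃ₜ X) (n : ℤ) : Continuous (deck T n) :=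
  ((continuous_zpow_toEquiv T n).comp continuous_fst).prodMk
    (continuous_snd.sub continuous_const)

/-- `π` exhibits `(Y, γ)` as the mapping torus of `T` with its suspension flow. -/
structure IsMappingTorus (T : X ≃ₜ X) (γ : Y → ℝ → Y) (π : X × ℝ → Y) : Prop where
  quot : IsQuotientMap π
  fib : ∀ p q, π p = π q ↔ ∃ n : ℤ, q = deck T n p
  flow : ∀ x t s, γ (π (x, t)) s = π (x, t + s)

namespace IsMappingTorus

lemma apply_deck {T : X ≃ₜ X} {γ : Y → ℝ → Y} {π : X × ℝ → Y} (hπ : IsMappingTorus T γ π)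
    (n : ℤ) (p : X × ℝ) : π (deck T n p) = π p :=
  ((hπ.fib _ _).2 ⟨n, rfl⟩).symm

lemma exists_addQuotientCoveringMap {T : X ≃ₜ X} {γ : Y → ℝ → Y} {π : X × ℝ → Y}
    (hπ : IsMappingTorus T γ π) :
    ∃ _ : AddAction ℤ (X × ℝ), IsAddQuotientCoveringMap π ℤ := by
  let act : AddAction ℤ (X × ℝ) :=
    { vadd := deck T
      zero_vadd := deck_zero T
      add_vadd := fun m n p => (deck_deck T m n p).symm }
  refine ⟨act, { toIsQuotientMap := hπ.quot, continuous_const_vadd := continuous_deck T,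
                 apply_eq_iff_mem_orbit := ?_, disjoint := ?_ }⟩
  · intro e₁ e₂
    rw [eq_comm, hπ.fib]
    exact ⟨fun ⟨n, hn⟩ => ⟨n, hn.symm⟩, fun ⟨n, hn⟩ => ⟨n, hn.symm⟩⟩
  · intro e
    refine ⟨Prod.snd ⁻¹' Metric.ball e.2 (1 / 2),
      continuous_snd.continuousAt.preimage_mem_nhds (Metric.ball_mem_nhds _ (by norm_num)), ?_⟩
    rintro n ⟨_, ⟨p, hp, rfl⟩, hq⟩
    have hq' : deck T n p ∈ Prod.snd ⁻¹' Metric.ball e.2 (1 / 2) := hq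
    simp only [mem_preimage, Metric.mem_ball, Real.dist_eq, deck_snd, abs_lt] at hp hq'
    have h1 : (n : ℝ) < 1 := by linarith
    have h2 : (-1 : ℝ) < n := by linarith
    have h1' : n < 1 := by exact_mod_cast h1
    have h2' : -1 < n := by exact_mod_cast h2
    omega

lemma isCoveringMap {T : X ≃ₜ X} {γ : Y → ℝ → Y} {π : X × ℝ → Y}
    (hπ : IsMappingTorus T γ π) : IsCoveringMap π := by
  obtain ⟨_, hc⟩ := hπ.exists_addQuotientCoveringMap
  exact hc.isCoveringMap

lemma isOpenQuotientMap {T : X ≃ₜ X} {γ : Y → ℝ → Y} {π : X × ℝ → Y}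
    (hπ : IsMappingTorus T γ π) : IsOpenQuotientMap π := by
  obtain ⟨_, hc⟩ := hπ.exists_addQuotientCoveringMap
  exact hc.isOpenQuotientMap

variable {T : X ≃ₜ X} {T₁ : X₁ ≃ₜ X₁} {T₂ : X₂ ≃ₜ X₂}
  {γ : Y → ℝ → Y} {γ₁ : Y₁ → ℝ → Y₁} {γ₂ : Y₂ → ℝ → Y₂}
  {π : X × ℝ → Y} {π₁ : X₁ × ℝ → Y₁} {π₂ : X₂ × ℝ → Y₂}

/-- An equivariant lift of a homeomorphism is a homeomorphism. -/
lemma isHomeomorph_lift (hπ₁ : IsMappingTorus T₁ γ₁ π₁) (hπ₂ : IsMappingTorus T₂ γ₂ π₂)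
    {h : Y₁ → Y₂} (hh : IsHomeomorph h) {F : X₁ × ℝ → X₂ × ℝ} (hF : Continuous F)
    (hlift : ∀ p, h (π₁ p) = π₂ (F p)) (heq : ∀ n p, F (deck T₁ n p) = deck T₂ n (F p)) :
    IsHomeomorph F := by
  have hloc : IsLocalHomeomorph F := by
    have h1 : IsLocalHomeomorph (π₂ ∘ F) := by
      have : π₂ ∘ F = h ∘ π₁ := funext fun p => (hlift p).symm
      rw [this]
      exact (hh.homeomorph h).isLocalHomeomorph.comp hπ₁.isCoveringMap.isLocalHomeomorph
    exact h1.of_comp hπ₂.isCoveringMap.isLocalHomeomorph hF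
  refine ⟨hF, hloc.isOpenMap, ?_, ?_⟩
  · intro p q hpq
    have h1 : π₁ p = π₁ q := hh.injective (by rw [hlift, hlift, hpq])
    obtain ⟨n, rfl⟩ := (hπ₁.fib _ _).1 h1
    rw [heq] at hpq
    have : (0 : ℤ) = n := deck_injective_left T₂ (F p) (by rw [deck_zero]; exact hpq)
    rw [← this, deck_zero]
  · intro q
    obtain ⟨y, hy⟩ := hh.surjective (π₂ q)
    obtain ⟨p, rfl⟩ := hπ₁.quot.surjective y
    rw [hlift] at hy
    obtain ⟨n, rfl⟩ := (hπ₂.fib _ _).1 hy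
    exact ⟨deck T₁ n p, heq n p⟩

open unitInterval in
/-- A homotopy starting at the identity has an equivariant lift ending at a lift of its end map. -/
lemma exists_lift_of_homotopy (hπ : IsMappingTorus T γ π) {j : Y → Y} {H : Y → ℝ → Y}
    (hH : ContinuousOn (fun p : Y × ℝ => H p.1 p.2) (univ ×ˢ Icc 0 1))
    (h0 : ∀ y, H y 0 = y) (h1 : ∀ y, H y 1 = j y) :
    ∃ F : X × ℝ → X × ℝ, Continuous F ∧ (∀ p, j (π p) = π (F p)) ∧
      ∀ n p, F (deck T n p) = deck T n (F p) := by
  let G : C(I × (X × ℝ), Y) := ⟨fun q => H (π q.2) q.1, by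
    refine hH.comp_continuous (f := fun q : I × (X × ℝ) => (π q.2, (q.1 : ℝ))) ?_ ?_
    · exact (hπ.quot.continuous.comp continuous_snd).prodMk
        (continuous_subtype_val.comp continuous_fst)
    · exact fun q => ⟨mem_univ _, q.1.2⟩⟩
  have hG0 : ∀ a, G (0, a) = π (ContinuousMap.id (X × ℝ) a) := fun a => by
    change H (π a) ((0 : I) : ℝ) = π a
    simp [h0]
  let cov := hπ.isCoveringMap
  let L := cov.liftHomotopy G (ContinuousMap.id _) hG0
  have hL : ∀ t a, π (L (t, a)) = H (π a) t := fun t a =>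
    congrFun (cov.liftHomotopy_lifts G (ContinuousMap.id _) hG0) (t, a)
  have hL0 : ∀ a, L (0, a) = a := fun a => cov.liftHomotopy_zero G (ContinuousMap.id _) hG0 a
  have hLc : ∀ a, Continuous fun t : I => L (t, a) := fun a =>
    L.continuous.comp (continuous_id.prodMk continuous_const)
  refine ⟨fun p => L (1, p), L.continuous.comp (continuous_const.prodMk continuous_id), ?_, ?_⟩
  · intro p
    rw [hL]
    simp [h1]
  · intro n p
    have := cov.eq_of_comp_eq (g₁ := fun t : I => L (t, deck T n p))
      (g₂ := fun t : I => deck T n (L (t, p))) (hLc _) ((continuous_deck T n).comp (hLc p)) (by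
        funext t
        simp only [Function.comp_apply, hπ.apply_deck, hL]) 0 (by simp only [hL0])
    exact congrFun this 1

end IsMappingTorus

end DeckTransformations

section Lifts

variable {X₁ X₂ Y₁ Y₂ : Type*} [TopologicalSpace X₁]
  [TopologicalSpace X₂] [TopologicalSpace Y₁] [TopologicalSpace Y₂]

lemma fst_apply_eq_of_totallyDisconnected [TotallyDisconnectedSpace X₂]
    {F : X₁ × ℝ → X₂ × ℝ} (hF : Continuous F) (x : X₁) (s t : ℝ) :
    (F (x, s)).1 = (F (x, t)).1 := by
  have hc : Continuous fun s : ℝ => (F (x, s)).1 :=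
    continuous_fst.comp (hF.comp (continuous_const.prodMk continuous_id))
  exact (isPreconnected_range hc).subsingleton ⟨s, rfl⟩ ⟨t, rfl⟩

lemma IsPreconnected.eq_of_intCast {Z : Type*} [TopologicalSpace Z] {S : Set Z}
    (hS : IsPreconnected S) {d : Z → ℝ} (hd : ContinuousOn d S)
    {n : Z → ℤ} (hn : ∀ z ∈ S, d z = n z) {a b : Z} (ha : a ∈ S) (hb : b ∈ S) : d a = d b := by
  have hc : ContinuousOn n S := by
    rw [Int.isClosedEmbedding_coe_real.isInducing.continuousOn_iff]
    exact hd.congr fun z hz => (hn z hz).symm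
  rw [hn a ha, hn b hb, hS.constant hc ha hb]

lemma snd_surjective [TotallyDisconnectedSpace X₁] [TotallyDisconnectedSpace X₂]
    (F : X₁ × ℝ ≃ₜ X₂ × ℝ) (x : X₁) : Function.Surjective fun s => (F (x, s)).2 := by
  intro r
  have h1 : (F.symm ((F (x, 0)).1, r)).1 = x := by
    rw [fst_apply_eq_of_totallyDisconnected F.symm.continuous _ r (F (x, 0)).2]
    simp
  refine ⟨(F.symm ((F (x, 0)).1, r)).2, ?_⟩
  have h2 : (x, (F.symm ((F (x, 0)).1, r)).2) = F.symm ((F (x, 0)).1, r) :=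
    Prod.ext h1.symm rfl
  simp [h2]

variable {T₁ : X₁ ≃ₜ X₁} {T₂ : X₂ ≃ₜ X₂} {γ₁ : Y₁ → ℝ → Y₁} {γ₂ : Y₂ → ℝ → Y₂}
  {π₁ : X₁ × ℝ → Y₁} {π₂ : X₂ × ℝ → Y₂}

/-- A lift of a flow map preserves the orientation of the fibres `{x} × ℝ`. -/
lemma strictMono_snd_of_lift [TotallyDisconnectedSpace X₂] (hπ₁ : IsMappingTorus T₁ γ₁ π₁)
    (hπ₂ : IsMappingTorus T₂ γ₂ π₂) {h : Y₁ → Y₂} (hflow : IsFlowMap γ₁ γ₂ h)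
    (F : X₁ × ℝ ≃ₜ X₂ × ℝ) (hlift : ∀ p, h (π₁ p) = π₂ (F p)) (x : X₁) :
    StrictMono fun s => (F (x, s)).2 := by
  have hc : Continuous fun s => (F (x, s)).2 := by fun_prop
  have hinj : Function.Injective fun s => (F (x, s)).2 := fun s t hst => by
    have := F.injective (Prod.ext (fst_apply_eq_of_totallyDisconnected F.continuous x s t) hst)
    exact congrArg Prod.snd this
  refine (hc.strictMono_of_inj hinj).resolve_right fun hanti => ?_
  obtain ⟨ε, hε, c, hcc, hcm, hc0, hγ⟩ := hflow.2.2 (π₁ (x, 0))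
  have hint : ∀ t ∈ Ioo (-ε) ε, ∃ n : ℤ, (F (x, t)).2 - (F (x, 0)).2 - c t = n := by
    intro t ht
    have h1 := hγ t (abs_lt.2 ht)
    rw [hπ₁.flow, zero_add, hlift, hlift, ← Prod.mk.eta (p := F (x, 0)), hπ₂.flow] at h1
    obtain ⟨n, hn⟩ := (hπ₂.fib _ _).1 h1
    refine ⟨n, ?_⟩
    have := congrArg Prod.snd hn
    simp only [deck_snd] at this
    linarith
  choose! n hn using hint
  have h0 : (0 : ℝ) ∈ Ioo (-ε) ε := ⟨by linarith, hε⟩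
  have h2 : ε / 2 ∈ Ioo (-ε) ε := ⟨by linarith, by linarith⟩
  have key := isPreconnected_Ioo.eq_of_intCast
    ((hc.sub continuous_const).continuousOn.sub hcc) hn h2 h0
  have h3 := hcm h0 h2 (by linarith)
  have h4 : (F (x, ε / 2)).2 < (F (x, 0)).2 := hanti (by linarith : (0 : ℝ) < ε / 2)
  simp only [Pi.sub_apply, hc0] at key h3
  linarith

end Lifts

section IndexOfBijection

/-- The indicator of the nonnegative integers. -/
def nonnegIndicator (k : ℤ) : ℤ := if 0 ≤ k then 1 else 0

lemma finite_support_nonnegIndicator_sub (k : ℤ) :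
    (Function.support fun l => nonnegIndicator l - nonnegIndicator (l - k)).Finite := by
  refine (finite_Icc (-|k|) |k|).subset fun l hl => ?_
  rw [Function.mem_support] at hl
  unfold nonnegIndicator at hl
  have := le_abs_self k
  have := neg_abs_le k
  constructor
  · by_contra hlt
    exact hl (by rw [if_neg (by omega), if_neg (by omega)]; rfl)
  · by_contra hlt
    exact hl (by rw [if_pos (by omega), if_pos (by omega)]; rfl)

lemma finsum_nonnegIndicator_sub (k : ℤ) :
    ∑ᶠ l, (nonnegIndicator l - nonnegIndicator (l - k)) = k := by
  rcases le_total 0 k with hk | hk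
  · have : (fun l => nonnegIndicator l - nonnegIndicator (l - k)) =
        fun l => if l ∈ Finset.Ico 0 k then 1 else 0 := by
      funext l
      simp only [nonnegIndicator, Finset.mem_Ico]
      split_ifs <;> omega
    rw [this, finsum_eq_sum_of_support_subset (s := Finset.Ico 0 k) _ (by
      intro l hl; by_contra h'; exact hl (if_neg (by simpa using h')))]
    rw [Finset.sum_congr rfl fun l hl => if_pos hl]
    simp [hk]
  · have : (fun l => nonnegIndicator l - nonnegIndicator (l - k)) =
        fun l => if l ∈ Finset.Ico k 0 then -1 else 0 := by
      funext l
      simp only [nonnegIndicator, Finset.mem_Ico]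
      split_ifs <;> omega
    rw [this, finsum_eq_sum_of_support_subset (s := Finset.Ico k 0) _ (by
      intro l hl; by_contra h'; exact hl (if_neg (by simpa using h')))]
    rw [Finset.sum_congr rfl fun l hl => if_pos hl]
    simp [hk]

/-- The number of integers that `e` moves from the negative to the nonnegative ones, minus the
number of integers moved in the opposite direction. -/
noncomputable def crossingIndex (e : ℤ → ℤ) : ℤ :=
  ∑ᶠ l, (nonnegIndicator (e l) - nonnegIndicator l)

lemma crossingIndex_shift {e : ℤ → ℤ} (he : Function.Bijective e)
    (hfin : (Function.support fun l => nonnegIndicator (e l) - nonnegIndicator l).Finite)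
    (k m : ℤ) :
    crossingIndex (fun l => e (l + k) - m) = crossingIndex e + k - m := by
  have h1 : crossingIndex (fun l => e (l + k) - m) =
      ∑ᶠ l, (nonnegIndicator (e l - m) - nonnegIndicator (l - k)) := by
    rw [← finsum_comp_equiv (Equiv.addRight k)]
    simp [crossingIndex]
  have h2 : ∀ l, nonnegIndicator (e l - m) - nonnegIndicator (l - k) =
      (nonnegIndicator (e l) - nonnegIndicator l) +
        (nonnegIndicator l - nonnegIndicator (l - k)) -
        (nonnegIndicator (e l) - nonnegIndicator (e l - m)) := fun l => by ring
  have h3 : (Function.support fun l => nonnegIndicator (e l) - nonnegIndicator (e l - m)).Finite :=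
    (finite_support_nonnegIndicator_sub m).preimage he.injective.injOn
  have h4 : ∑ᶠ l, (nonnegIndicator (e l) - nonnegIndicator (e l - m)) = m := by
    exact (finsum_comp_equiv (Equiv.ofBijective e he)
      (f := fun l => nonnegIndicator l - nonnegIndicator (l - m))).trans
      (finsum_nonnegIndicator_sub m)
  have h5 := finite_support_nonnegIndicator_sub k
  rw [h1]
  simp only [h2]
  rw [finsum_sub_distrib ((hfin.union h5).subset (Function.support_add _ _)) h3,
    finsum_add_distrib hfin h5, h4, finsum_nonnegIndicator_sub]
  rfl

end IndexOfBijection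

section Straightening

variable {X₁ X₂ Y₁ Y₂ : Type*} [TopologicalSpace X₁] [TopologicalSpace X₂]
  [TopologicalSpace Y₁] [TopologicalSpace Y₂]
  {T₁ : X₁ ≃ₜ X₁} {T₂ : X₂ ≃ₜ X₂} {γ₁ : Y₁ → ℝ → Y₁} {γ₂ : Y₂ → ℝ → Y₂}
  {π₁ : X₁ × ℝ → Y₁} {π₂ : X₂ × ℝ → Y₂}

/-- How a homeomorphic lift of a flow equivalence transforms deck transformations. -/
lemma IsMappingTorus.exists_cocycle (hπ₁ : IsMappingTorus T₁ γ₁ π₁)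
    (hπ₂ : IsMappingTorus T₂ γ₂ π₂) {h : Y₁ → Y₂} (hh : Function.Injective h)
    (f : X₁ × ℝ ≃ₜ X₂ × ℝ) (hlift : ∀ p, h (π₁ p) = π₂ (f p)) :
    ∃ N : X₁ → ℤ → ℤ, (∀ k, Continuous fun x => N x k) ∧ (∀ x, Function.Bijective (N x)) ∧
      ∀ k p, f (deck T₁ k p) = deck T₂ (N p.1 k) (f p) := by
  have hex : ∀ p k, ∃ n : ℤ, f (deck T₁ k p) = deck T₂ n (f p) := fun p k =>
    (hπ₂.fib _ _).1 (by rw [← hlift, ← hlift, hπ₁.apply_deck])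
  choose n hn using hex
  have hcast : ∀ p k, (n p k : ℝ) = (f p).2 - (f (deck T₁ k p)).2 := fun p k => by
    rw [hn, deck_snd]; ring
  have hnc : ∀ k, Continuous fun p => n p k := fun k => by
    rw [Int.isClosedEmbedding_coe_real.isInducing.continuous_iff]
    have h1 : Continuous fun p => (f (deck T₁ k p)).2 :=
      continuous_snd.comp (f.continuous.comp (continuous_deck T₁ k))
    have h2 : Continuous fun p => (f p).2 := continuous_snd.comp f.continuous
    exact (h2.sub h1).congr fun p => (hcast p k).symm
  have hconst : ∀ p k, n p k = n (p.1, 0) k := fun p k => by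
    have hc : Continuous fun s : ℝ => n (p.1, s) k :=
      (hnc k).comp (continuous_const.prodMk continuous_id)
    exact PreconnectedSpace.constant inferInstance hc (x := p.2) (y := 0)
  refine ⟨fun x k => n (x, 0) k, fun k => (hnc k).comp (by fun_prop), fun x => ⟨?_, ?_⟩, ?_⟩
  · intro k l hkl
    have hkl' : n (x, 0) k = n (x, 0) l := hkl
    have h1 : f (deck T₁ k (x, 0)) = f (deck T₁ l (x, 0)) := by rw [hn, hn, hkl']
    exact deck_injective_left T₁ _ (f.injective h1)
  · intro m
    obtain ⟨q, hq⟩ := f.surjective (deck T₂ m (f (x, 0)))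
    have h1 : π₁ (x, 0) = π₁ q := hh (by rw [hlift, hlift, hq, hπ₂.apply_deck])
    obtain ⟨k, rfl⟩ := (hπ₁.fib _ _).1 h1
    rw [hn] at hq
    exact ⟨k, deck_injective_left T₂ _ hq⟩
  · intro k p
    rw [hn, hconst]

variable [CompactSpace X₁]

lemma exists_nat_forall_lt {g : X₁ × ℝ → ℝ} (hg : Continuous g)
    (hmono : ∀ x, StrictMono fun s => g (x, s))
    (hsurj : ∀ x, Function.Surjective fun s => g (x, s)) (M : ℝ) :
    ∃ K : ℕ, ∀ x, M < g (x, K) := by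
  obtain ⟨K, hK⟩ := isCompact_univ.elim_directed_cover (fun K : ℕ => {x : X₁ | M < g (x, K)})
    (fun K => isOpen_lt continuous_const (by fun_prop))
    (fun x _ => by
      obtain ⟨s, hs⟩ := hsurj x (M + 1)
      obtain ⟨K, hK⟩ := exists_nat_ge s
      have h1 : g (x, s) ≤ g (x, K) := (hmono x).monotone hK
      have h2 : g (x, s) = M + 1 := hs
      exact mem_iUnion.2 ⟨K, show M < g (x, K) by linarith⟩)
    (directed_of_isDirected_le fun a b hab x hx =>
      lt_of_lt_of_le hx ((hmono x).monotone (Nat.cast_le.2 hab)))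
  exact ⟨K, fun x => hK (mem_univ x)⟩

lemma exists_nat_forall_gt {g : X₁ × ℝ → ℝ} (hg : Continuous g)
    (hmono : ∀ x, StrictMono fun s => g (x, s))
    (hsurj : ∀ x, Function.Surjective fun s => g (x, s)) (M : ℝ) :
    ∃ K : ℕ, ∀ x, g (x, -K) < M := by
  obtain ⟨K, hK⟩ := exists_nat_forall_lt (g := fun p => -g (p.1, -p.2)) (by fun_prop)
    (fun x s t hst => neg_lt_neg (hmono x (neg_lt_neg hst)))
    (fun x r => by
      obtain ⟨s, hs⟩ := hsurj x (-r)
      exact ⟨-s, by simpa using congrArg Neg.neg hs⟩) (-M)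
  exact ⟨K, fun x => neg_lt_neg_iff.1 (hK x)⟩

variable [TotallyDisconnectedSpace X₁] [TotallyDisconnectedSpace X₂]

/-- A flow equivalence with a homeomorphic lift has an equivariant homeomorphic lift. -/
lemma IsMappingTorus.exists_equivariant_lift (hπ₁ : IsMappingTorus T₁ γ₁ π₁)
    (hπ₂ : IsMappingTorus T₂ γ₂ π₂) {h : Y₁ → Y₂} (hflow : IsFlowMap γ₁ γ₂ h)
    (hh : IsHomeomorph h) (f : X₁ × ℝ ≃ₜ X₂ × ℝ) (hlift : ∀ p, h (π₁ p) = π₂ (f p)) :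
    ∃ F : X₁ × ℝ ≃ₜ X₂ × ℝ, (∀ p, h (π₁ p) = π₂ (F p)) ∧
      ∀ n p, F (deck T₁ n p) = deck T₂ n (F p) := by
  obtain ⟨N, hNc, hNb, hN⟩ := hπ₁.exists_cocycle hπ₂ hh.injective f hlift
  have hgc : Continuous fun p => (f p).2 := continuous_snd.comp f.continuous
  have hmono := strictMono_snd_of_lift hπ₁ hπ₂ hflow f hlift
  have hsurj := snd_surjective f
  obtain ⟨M, hM⟩ := isCompact_univ.exists_bound_of_continuousOn
    (f := fun x : X₁ => (f (x, 0)).2) (by fun_prop)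
  have hbound : ∀ x k, |(f (x, (k : ℤ))).2 - N x k| ≤ M := fun x k => by
    have h1 := hM ((T₁.toEquiv ^ k) x) (mem_univ _)
    have h2 : deck T₁ k (x, (k : ℝ)) = ((T₁.toEquiv ^ k) x, 0) := by simp [deck]
    rw [← h2, hN] at h1
    exact h1
  obtain ⟨K₁, hK₁⟩ := exists_nat_forall_lt hgc hmono hsurj M
  obtain ⟨K₂, hK₂⟩ := exists_nat_forall_gt hgc hmono hsurj (-M)
  have hsupp : ∀ x, (Function.support fun l => nonnegIndicator (N x l) - nonnegIndicator l) ⊆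
      Finset.Icc (-(K₂ : ℤ)) K₁ := by
    intro x l hl
    rw [Function.mem_support] at hl
    have hb := abs_le.1 (hbound x l)
    rw [Finset.coe_Icc]
    constructor
    · by_contra hlt
      have hlt' : l < -(K₂ : ℤ) := not_le.1 hlt
      have h1 : (f (x, (l : ℝ))).2 < (f (x, -(K₂ : ℝ))).2 := hmono x (by exact_mod_cast hlt')
      have h2 := hK₂ x
      have h3 : (N x l : ℝ) < 0 := by linarith
      have h4 : N x l < 0 := by exact_mod_cast h3
      exact hl (by rw [nonnegIndicator, nonnegIndicator, if_neg (by omega), if_neg (by omega)]; rfl)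
    · by_contra hlt
      have hlt' : (K₁ : ℤ) < l := not_le.1 hlt
      have h1 : (f (x, (K₁ : ℝ))).2 < (f (x, (l : ℝ))).2 := hmono x (by exact_mod_cast hlt')
      have h2 := hK₁ x
      have h3 : (0 : ℝ) < N x l := by linarith
      have h4 : 0 < N x l := by exact_mod_cast h3
      exact hl (by rw [nonnegIndicator, nonnegIndicator, if_pos (by omega), if_pos (by omega)]; rfl)
  have hcc : Continuous fun x => crossingIndex (N x) := by
    have : (fun x => crossingIndex (N x)) = fun x =>
        ∑ l ∈ Finset.Icc (-(K₂ : ℤ)) K₁, (nonnegIndicator (N x l) - nonnegIndicator l) :=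
      funext fun x => finsum_eq_sum_of_support_subset _ (hsupp x)
    rw [this]
    exact continuous_finsetSum _ fun l _ => (continuous_of_discreteTopology
      (f := fun n => nonnegIndicator n - nonnegIndicator l)).comp (hNc l)
  have hcoc : ∀ x k l, N ((T₁.toEquiv ^ k) x) l = N x (l + k) - N x k := by
    intro x k l
    have h1 := hN l (deck T₁ k (x, 0))
    rw [deck_deck, hN, hN, deck_deck] at h1
    have h2 := deck_injective_left T₂ _ h1
    change N x (l + k) = N ((T₁.toEquiv ^ k) x) l + N x k at h2
    omega
  have hidx : ∀ x k, crossingIndex (N ((T₁.toEquiv ^ k) x)) = crossingIndex (N x) + k - N x k := by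
    intro x k
    rw [← crossingIndex_shift (hNb x) ((Finset.finite_toSet _).subset (hsupp x))]
    exact congrArg crossingIndex (funext (hcoc x k))
  let F : X₁ × ℝ → X₂ × ℝ := fun p => deck T₂ (crossingIndex (N p.1)) (f p)
  have hFc : Continuous F := by
    have hd : Continuous fun q : ℤ × (X₂ × ℝ) => deck T₂ q.1 q.2 :=
      continuous_prod_of_discrete_left.2 fun n => continuous_deck T₂ n
    exact hd.comp ((hcc.comp continuous_fst).prodMk f.continuous)
  have hFl : ∀ p, h (π₁ p) = π₂ (F p) := fun p => by rw [hπ₂.apply_deck, hlift]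
  have hFeq : ∀ n p, F (deck T₁ n p) = deck T₂ n (F p) := by
    intro n p
    change deck T₂ (crossingIndex (N ((T₁.toEquiv ^ n) p.1))) (f (deck T₁ n p)) =
      deck T₂ n (deck T₂ (crossingIndex (N p.1)) (f p))
    rw [hN, deck_deck, deck_deck, hidx]
    congr 1
    ring
  exact ⟨(hπ₁.isHomeomorph_lift hπ₂ hh hFc hFl hFeq).homeomorph F, hFl, hFeq⟩

end Straightening

section FibrewiseMaps

variable {X Y : Type*} [TopologicalSpace X] [TopologicalSpace Y]

/-- The self-map `[x, t] ↦ [x, U (x, t)]` of the mapping torus. -/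
noncomputable def fibrewiseMap {π : X × ℝ → Y} (hs : Function.Surjective π) (U : X × ℝ → ℝ)
    (y : Y) : Y :=
  π ((Function.surjInv hs y).1, U (Function.surjInv hs y))

namespace IsMappingTorus

variable {T : X ≃ₜ X} {γ : Y → ℝ → Y} {π : X × ℝ → Y}

lemma fibrewiseMap_apply (hπ : IsMappingTorus T γ π) {U : X × ℝ → ℝ}
    (hU : ∀ n p, U (deck T n p) = U p - n) (p : X × ℝ) :
    fibrewiseMap hπ.quot.surjective U (π p) = π (p.1, U p) := by
  obtain ⟨n, hn⟩ := (hπ.fib p _).1 (Function.surjInv_eq hπ.quot.surjective (π p)).symm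
  unfold fibrewiseMap
  rw [hn, hU]
  exact hπ.apply_deck n (p.1, U p)

lemma memHomeoPlusOrb_fibrewiseMap [CompactSpace Y] [T2Space Y] (hπ : IsMappingTorus T γ π)
    {U : X × ℝ → ℝ} (hUc : Continuous U) (hU : ∀ n p, U (deck T n p) = U p - n)
    (hmono : ∀ x, StrictMono fun s => U (x, s))
    (hsurj : ∀ x, Function.Surjective fun s => U (x, s)) :
    MemHomeoPlusOrb γ (fibrewiseMap hπ.quot.surjective U) := by
  have happ := hπ.fibrewiseMap_apply hU
  have hc : Continuous (fibrewiseMap hπ.quot.surjective U) := by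
    rw [hπ.quot.continuous_iff]
    exact (hπ.quot.continuous.comp (continuous_fst.prodMk hUc)).congr fun p => (happ p).symm
  have horb : ∀ x t, flowOrbit γ (π (x, t)) = range fun s => π (x, s) := by
    intro x t
    ext y
    constructor
    · rintro ⟨s, rfl⟩
      exact ⟨t + s, (hπ.flow x t s).symm⟩
    · rintro ⟨s, rfl⟩
      exact ⟨s - t, by rw [hπ.flow]; simp⟩
  have himage : ∀ x t, fibrewiseMap hπ.quot.surjective U '' flowOrbit γ (π (x, t)) =
      range fun s => π (x, s) := by
    intro x t
    rw [horb, ← range_comp]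
    have : (fibrewiseMap hπ.quot.surjective U ∘ fun s => π (x, s)) =
        (fun s => π (x, s)) ∘ fun s => U (x, s) := funext fun s => happ (x, s)
    rw [this, (hsurj x).range_comp]
  refine ⟨⟨⟨hc, ?_, ?_⟩, ?_⟩, ?_⟩
  · intro y
    obtain ⟨⟨x, t⟩, rfl⟩ := hπ.quot.surjective y
    rw [himage, happ, horb]
  · intro y
    obtain ⟨⟨x, t⟩, rfl⟩ := hπ.quot.surjective y
    refine ⟨1, one_pos, fun s => U (x, t + s) - U (x, t), by fun_prop, ?_, by simp, ?_⟩
    · intro a _ b _ hab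
      exact sub_lt_sub_right (hmono x (by linarith : t + a < t + b)) _
    · intro s _
      rw [hπ.flow, happ, happ, hπ.flow]
      simp
  · refine isHomeomorph_iff_continuous_bijective.2 ⟨hc, ?_, ?_⟩
    · intro y y' hyy
      obtain ⟨p, rfl⟩ := hπ.quot.surjective y
      obtain ⟨q, rfl⟩ := hπ.quot.surjective y'
      rw [happ, happ] at hyy
      obtain ⟨n, hn⟩ := (hπ.fib _ _).1 hyy
      have h1 : q.1 = (deck T n p).1 := (Prod.ext_iff.1 hn).1
      have h2 : U q = U (deck T n p) := (congrArg Prod.snd hn).trans (hU n p).symm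
      have h3 : q = deck T n p := by
        refine Prod.ext h1 ((hmono q.1).injective ?_)
        change U q = U (q.1, (deck T n p).2)
        rw [h2, h1]
      rw [h3, hπ.apply_deck]
    · intro y
      obtain ⟨⟨x, t⟩, rfl⟩ := hπ.quot.surjective y
      obtain ⟨s, hs⟩ := hsurj x t
      exact ⟨π (x, s), (happ _).trans (congrArg (fun r => π (x, r)) hs)⟩
  · intro y
    obtain ⟨⟨x, t⟩, rfl⟩ := hπ.quot.surjective y
    rw [himage, horb]

/-- The straight-line isotopy from the identity to a fibrewise map. -/
lemma memHomeoPlusIso_fibrewiseMap [CompactSpace Y] [T2Space Y] (hπ : IsMappingTorus T γ π)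
    {U : X × ℝ → ℝ} (hUc : Continuous U) (hU : ∀ n p, U (deck T n p) = U p - n)
    (hmono : ∀ x, StrictMono fun s => U (x, s))
    (hsurj : ∀ x, Function.Surjective fun s => U (x, s)) :
    MemHomeoPlusIso γ (fibrewiseMap hπ.quot.surjective U) := by
  let V : ℝ → X × ℝ → ℝ := fun τ p => (1 - τ) * p.2 + τ * U p
  have hV : ∀ τ n p, V τ (deck T n p) = V τ p - n := fun τ n p => by
    simp only [V, hU, deck_snd]; ring
  have happ := fun τ => hπ.fibrewiseMap_apply (hV τ)
  refine ⟨hπ.memHomeoPlusOrb_fibrewiseMap hUc hU hmono hsurj,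
    fun y τ => fibrewiseMap hπ.quot.surjective (V τ) y, ?_, ?_, ?_, ?_⟩
  · refine Continuous.continuousOn ?_
    refine (hπ.isOpenQuotientMap.prodMap
      (IsOpenQuotientMap.id (X := ℝ))).isQuotientMap.continuous_iff.2 ?_
    have : Continuous fun q : (X × ℝ) × ℝ => π (q.1.1, V q.2 q.1) :=
      hπ.quot.continuous.comp (by fun_prop)
    exact this.congr fun q => (happ q.2 q.1).symm
  · rintro τ ⟨h0, h1⟩
    have hVm : ∀ x, StrictMono fun s => V τ (x, s) := by
      intro x a b hab
      have h2 := hmono x hab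
      simp only [V]
      rcases h0.eq_or_lt with rfl | h0
      · simpa using hab
      · have h3 := mul_lt_mul_of_pos_left h2 h0
        have h4 := mul_le_mul_of_nonneg_left hab.le (sub_nonneg.2 h1)
        exact add_lt_add_of_le_of_lt h4 h3
    refine (hπ.memHomeoPlusOrb_fibrewiseMap (by fun_prop) (hV τ) hVm fun x r => ?_).1
    obtain ⟨s, hs⟩ := hsurj x r
    have hs' : U (x, s) = r := hs
    refine mem_range_of_exists_le_of_exists_ge (by fun_prop) ⟨min s r, ?_⟩ ⟨max s r, ?_⟩
    · have h2 : U (x, min s r) ≤ r := ((hmono x).monotone (min_le_left s r)).trans hs'.le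
      have h3 := min_le_right s r
      simp only [V]
      nlinarith
    · have h2 : r ≤ U (x, max s r) := hs'.ge.trans ((hmono x).monotone (le_max_left s r))
      have h3 := le_max_right s r
      simp only [V]
      nlinarith
  · intro y
    obtain ⟨p, rfl⟩ := hπ.quot.surjective y
    exact (happ 0 p).trans (by simp [V])
  · intro y
    obtain ⟨p, rfl⟩ := hπ.quot.surjective y
    exact (happ 1 p).trans (by simp [hπ.fibrewiseMap_apply hU, V])

end IsMappingTorus

end FibrewiseMaps

section Conjugacy

variable {X₁ X₂ Y₁ Y₂ : Type*} [TopologicalSpace X₁] [CompactSpace X₁]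
  [TotallyDisconnectedSpace X₁] [TopologicalSpace X₂] [T2Space X₂] [TotallyDisconnectedSpace X₂]
  [TopologicalSpace Y₁] [CompactSpace Y₁] [T2Space Y₁] [TopologicalSpace Y₂]
  {T₁ : X₁ ≃ₜ X₁} {T₂ : X₂ ≃ₜ X₂} {γ₁ : Y₁ → ℝ → Y₁} {γ₂ : Y₂ → ℝ → Y₂}
  {π₁ : X₁ × ℝ → Y₁} {π₂ : X₂ × ℝ → Y₂}

lemma IsMappingTorus.exists_conjugacy_of_equivariant_lift (hπ₁ : IsMappingTorus T₁ γ₁ π₁)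
    (hπ₂ : IsMappingTorus T₂ γ₂ π₂) {h : Y₁ → Y₂} (hflow : IsFlowMap γ₁ γ₂ h)
    (F : X₁ × ℝ ≃ₜ X₂ × ℝ) (hF : ∀ p, h (π₁ p) = π₂ (F p))
    (hFeq : ∀ n p, F (deck T₁ n p) = deck T₂ n (F p)) :
    ∃ j : Y₁ → Y₁, MemHomeoPlusIso γ₁ j ∧
      ∃ φ : X₁ → X₂, IsHomeomorph φ ∧ (∀ x, φ (T₁ x) = T₂ (φ x)) ∧
        ∀ (x : X₁) (t : ℝ), h (j (π₁ (x, t))) = π₂ (φ x, t) := by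
  let φ : X₁ → X₂ := fun x => (F (x, 0)).1
  have hφc : Continuous φ := by fun_prop
  have hφ : ∀ p, (F p).1 = φ p.1 := fun p =>
    fst_apply_eq_of_totallyDisconnected F.continuous p.1 p.2 0
  have hmono := strictMono_snd_of_lift hπ₁ hπ₂ hflow F hF
  have hsurj := snd_surjective F
  have hφdeck : ∀ n p, φ (deck T₁ n p).1 = (T₂.toEquiv ^ n) (φ p.1) := fun n p => by
    rw [← hφ, ← hφ, hFeq]; rfl
  have hφinj : Function.Injective φ := by
    intro x x' hx
    obtain ⟨s, hs⟩ := hsurj x' (F (x, 0)).2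
    have : F (x', s) = F (x, 0) := Prod.ext ((hφ _).trans hx.symm) hs
    exact (congrArg Prod.fst (F.injective this)).symm
  have hφsurj : Function.Surjective φ := fun y => by
    obtain ⟨p, hp⟩ := F.surjective (y, 0)
    exact ⟨p.1, by rw [← hφ, hp]⟩
  let U : X₁ × ℝ → ℝ := fun p => (F.symm (φ p.1, p.2)).2
  have hUc : Continuous U := by fun_prop
  have hFU : ∀ p, F (p.1, U p) = (φ p.1, p.2) := by
    intro p
    have h1 : (F.symm (φ p.1, p.2)).1 = p.1 := hφinj (by rw [← hφ, F.apply_symm_apply])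
    have h2 : (p.1, U p) = F.symm (φ p.1, p.2) := Prod.ext h1.symm rfl
    rw [h2, F.apply_symm_apply]
  have hU : ∀ n p, U (deck T₁ n p) = U p - n := by
    intro n p
    have h1 : F ((deck T₁ n p).1, U (deck T₁ n p)) = F (deck T₁ n (p.1, U p)) := by
      rw [hFU, hFeq, hFU, hφdeck]
      rfl
    exact congrArg Prod.snd (F.injective h1)
  have hUl : ∀ x, Function.RightInverse (fun s => U (x, s)) fun s => (F (x, s)).2 :=
    fun x s => congrArg Prod.snd (hFU (x, s))
  have hUm : ∀ x, StrictMono fun s => U (x, s) := fun x a b hab =>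
    (hmono x).lt_iff_lt.1 ((hUl x a).trans_lt (hab.trans_eq (hUl x b).symm))
  have hUs : ∀ x, Function.Surjective fun s => U (x, s) := fun x s =>
    ⟨(F (x, s)).2, (hmono x).injective (hUl x _)⟩
  refine ⟨_, hπ₁.memHomeoPlusIso_fibrewiseMap hUc hU hUm hUs, φ,
    isHomeomorph_iff_continuous_bijective.2 ⟨hφc, hφinj, hφsurj⟩, fun x => ?_, fun x t => ?_⟩
  · simpa [deck] using hφdeck 1 (x, 0)
  · rw [hπ₁.fibrewiseMap_apply hU, hF, hFU]

end Conjugacy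

/-- Proposition 6.7 of the paper: a flow equivalence of suspension flows of homeomorphisms of
compact totally disconnected metric spaces lifts to a homeomorphism of the covering spaces
`X₁ × ℝ → X₂ × ℝ` iff it is isotopic to an equivalence induced by a topological conjugacy.
Here `Yᵢ` with quotient map `πᵢ : Xᵢ × ℝ → Yᵢ` is a model of the mapping torus of `Tᵢ`,
with suspension flow `γᵢ`. -/
theorem lift_iff_induced_by_conjugacy
    {X₁ X₂ : Type*} [MetricSpace X₁] [CompactSpace X₁] [TotallyDisconnectedSpace X₁]
    [MetricSpace X₂] [CompactSpace X₂] [TotallyDisconnectedSpace X₂]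
    (T₁ : X₁ ≃ₜ X₁) (T₂ : X₂ ≃ₜ X₂)
    {Y₁ Y₂ : Type*} [MetricSpace Y₁] [CompactSpace Y₁] [MetricSpace Y₂] [CompactSpace Y₂]
    (γ₁ : Y₁ → ℝ → Y₁) (γ₂ : Y₂ → ℝ → Y₂) (hγ₁ : IsFlow γ₁) (hγ₂ : IsFlow γ₂)
    (π₁ : X₁ × ℝ → Y₁) (π₂ : X₂ × ℝ → Y₂)
    (hπ₁q : IsQuotientMap π₁) (hπ₂q : IsQuotientMap π₂)
    (hπ₁fib : ∀ (x x' : X₁) (t t' : ℝ), π₁ (x, t) = π₁ (x', t') ↔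
      ∃ n : ℤ, x' = (T₁.toEquiv ^ n) x ∧ t' = t - n)
    (hπ₂fib : ∀ (x x' : X₂) (t t' : ℝ), π₂ (x, t) = π₂ (x', t') ↔
      ∃ n : ℤ, x' = (T₂.toEquiv ^ n) x ∧ t' = t - n)
    (hπ₁flow : ∀ (x : X₁) (t s : ℝ), γ₁ (π₁ (x, t)) s = π₁ (x, t + s))
    (hπ₂flow : ∀ (x : X₂) (t s : ℝ), γ₂ (π₂ (x, t)) s = π₂ (x, t + s))
    (h : Y₁ → Y₂) (hflow : IsFlowMap γ₁ γ₂ h) (hhomeo : IsHomeomorph h) :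
    (∃ j : Y₁ → Y₁, MemHomeoPlusIso γ₁ j ∧
        ∃ φ : X₁ → X₂, IsHomeomorph φ ∧ (∀ x, φ (T₁ x) = T₂ (φ x)) ∧
          ∀ (x : X₁) (t : ℝ), h (j (π₁ (x, t))) = π₂ (φ x, t)) ↔
    (∃ ht : X₁ × ℝ → X₂ × ℝ, IsHomeomorph ht ∧ ∀ p, h (π₁ p) = π₂ (ht p)) := by
  have hM₁ : IsMappingTorus T₁ γ₁ π₁ :=
    ⟨hπ₁q, fun p q => (hπ₁fib p.1 q.1 p.2 q.2).trans
      (exists_congr fun _ => by rw [Prod.ext_iff]; rfl), hπ₁flow⟩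
  have hM₂ : IsMappingTorus T₂ γ₂ π₂ :=
    ⟨hπ₂q, fun p q => (hπ₂fib p.1 q.1 p.2 q.2).trans
      (exists_congr fun _ => by rw [Prod.ext_iff]; rfl), hπ₂flow⟩
  constructor
  · rintro ⟨j, ⟨⟨⟨-, hj⟩, -⟩, H, hHc, -, hH0, hH1⟩, φ, hφ, -, hhj⟩
    obtain ⟨F, hFc, hF, hFeq⟩ := hM₁.exists_lift_of_homotopy hHc hH0 hH1
    let Φ := (hM₁.isHomeomorph_lift hM₁ hj hFc hF hFeq).homeomorph F
    refine ⟨_, (Φ.symm.trans ((hφ.homeomorph φ).prodCongr (Homeomorph.refl ℝ))).isHomeomorph,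
      fun p => ?_⟩
    obtain ⟨q, rfl⟩ := Φ.surjective p
    have h1 : Φ q = F q := rfl
    rw [h1, ← hF, ← Prod.mk.eta (p := q), hhj]
    simp only [Homeomorph.trans_apply, ← h1, Homeomorph.symm_apply_apply]
    rfl
  · rintro ⟨f, hf, hlift⟩
    obtain ⟨F, hF, hFeq⟩ := hM₁.exists_equivariant_lift hM₂ hflow hhomeo (hf.homeomorph f) hlift
    exact hM₁.exists_conjugacy_of_equivariant_lift hM₂ hflow F hF hFeq
end
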